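/- arXiv:1501.00740 — 3 statements merged into one kernel-verified Lean document; each statement's English description precedes it below -/
import Mathlib

section
/- For every integer m ≥ 0, the generalized Euler constant γ_m admits the convergent series representation γ_m = (1/2)·δ_{m,0} + ((−1)^m · m!/π) · Σ_{n=1}^{∞} (1/(n·n!)) · Σ_{k=0}^{⌊n/2⌋} (−1)^k · |S₁(2k+2, m+1)| · |S₁(n, 2k+1)| / (2π)^{2k+1}, where the outer series over n converges. -/
open Finset Filter Real

/-- Unsigned Stirling numbers of the first kind `|S₁(n,l)|`: the coefficients in the
expansion of the rising factorial `z(z+1)⋯(z+n−1) = Σ_l |S₁(n,l)| z^l`. -/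
noncomputable def S1 (n l : ℕ) : ℕ := (ascPochhammer ℕ n).coeff l

/-- The defining sequence for the `m`-th generalized Euler (Stieltjes) constant:
`Σ_{k=1}^n ln^m k / k − ln^{m+1} n / (m+1)`. -/
noncomputable def stieltjesSeq (m : ℕ) (n : ℕ) : ℝ :=
  (∑ k ∈ Finset.range n, (Real.log (k + 1)) ^ m / (k + 1)) -
    (Real.log n) ^ (m + 1) / (m + 1)

open scoped Nat Topology

section Stirling

theorem S1_succ_zero (n : ℕ) : S1 (n + 1) 0 = 0 := by
  have h := ascPochhammer_ne_zero_eval_zero (S := ℕ) (Nat.succ_ne_zero n)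
  rwa [← Polynomial.coeff_zero_eq_eval_zero] at h

theorem S1_succ_succ (n l : ℕ) : S1 (n + 1) (l + 1) = n * S1 n (l + 1) + S1 n l := by
  simp only [S1, ascPochhammer_succ_right, mul_add, Polynomial.coeff_add,
    Polynomial.coeff_mul_X]
  rw [← Polynomial.C_eq_natCast, Polynomial.coeff_mul_C]
  simp only [Nat.cast_id]
  ring

theorem S1_zero_right (n : ℕ) : n * S1 n 0 = 0 := by
  cases n with
  | zero => simp
  | succ n => simp [S1_succ_zero]

theorem S1_eq_zero_of_lt {n l : ℕ} (h : n < l) : S1 n l = 0 :=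
  Polynomial.coeff_eq_zero_of_natDegree_lt (by rwa [ascPochhammer_natDegree])

end Stirling

section LogPow

/-- The polynomial `p` for which the `l`-th derivative of `log z ^ m / z` is
`p (log z) / z ^ (l + 1)`. -/
noncomputable def logPoly (m : ℕ) : ℕ → Polynomial ℂ
  | 0 => Polynomial.X ^ m
  | l + 1 => Polynomial.derivative (logPoly m l) - Polynomial.C ((l : ℂ) + 1) * logPoly m l

theorem logPoly_coeff (m l : ℕ) :
    (∀ i j, i + j = m → (j ! : ℂ) * (logPoly m l).coeff j =
      (-1) ^ (l + i) * m ! * S1 (l + 1) (i + 1)) ∧ (logPoly m l).coeff (m + 1) = 0 ∧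
      (logPoly m l).natDegree ≤ m := by
  induction l with
  | zero =>
    refine ⟨fun i j hij => ?_, by simp [logPoly, Polynomial.coeff_X_pow],
      Polynomial.natDegree_X_pow_le m⟩
    subst hij
    rcases Nat.eq_zero_or_pos i with rfl | hi
    · simp [logPoly, S1]
    · simp only [logPoly, Polynomial.coeff_X_pow]
      rw [if_neg (by omega), S1_eq_zero_of_lt (by omega)]
      simp
  | succ l ih =>
    obtain ⟨h1, h2, h3⟩ := ih
    have h4 : (logPoly m (l + 1)).natDegree ≤ m := by
      refine (Polynomial.natDegree_sub_le _ _).trans (max_le ?_ ?_)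
      · exact (Polynomial.natDegree_derivative_le _).trans (by omega)
      · exact (Polynomial.natDegree_C_mul_le _ _).trans h3
    refine ⟨fun i j hij => ?_, Polynomial.coeff_eq_zero_of_natDegree_lt (by omega), h4⟩
    simp only [logPoly, Polynomial.coeff_sub, Polynomial.coeff_derivative,
      Polynomial.coeff_C_mul]
    rw [S1_succ_succ]
    have hj := h1 i j hij
    rcases i with _ | i
    · have : j = m := by omega
      subst this
      rw [h2, S1_succ_zero]
      push_cast at hj ⊢
      linear_combination (-(l + 1 : ℂ)) * hj
    · have hj' := h1 i (j + 1) (by omega)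
      rw [Nat.factorial_succ] at hj'
      push_cast at hj hj' ⊢
      linear_combination hj' - (l + 1 : ℂ) * hj

theorem logPoly_eval_zero (m l : ℕ) :
    (logPoly m l).eval 0 = (-1) ^ (l + m) * m ! * S1 (l + 1) (m + 1) := by
  simpa [Polynomial.coeff_zero_eq_eval_zero] using (logPoly_coeff m l).1 m 0 rfl

/-- The `l`-th derivative of `log z ^ m / z`. -/
noncomputable def logPowDiv (m l : ℕ) (z : ℂ) : ℂ :=
  (logPoly m l).eval (Complex.log z) / z ^ (l + 1)

theorem hasDerivAt_logPowDiv (m l : ℕ) {z : ℂ} (hz : z ∈ Complex.slitPlane) :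
    HasDerivAt (logPowDiv m l) (logPowDiv m (l + 1) z) z := by
  have hz0 := Complex.slitPlane_ne_zero hz
  have h := (((logPoly m l).hasDerivAt (Complex.log z)).comp z
    (Complex.hasDerivAt_log hz)).div (hasDerivAt_pow (l + 1) z) (pow_ne_zero _ hz0)
  refine h.congr_deriv ?_
  simp only [logPowDiv, logPoly, Polynomial.eval_sub, Polynomial.eval_mul, Polynomial.eval_C,
    Function.comp]
  field_simp
  push_cast
  ring

theorem logPowDiv_one (m l : ℕ) :
    logPowDiv m l 1 = (-1) ^ (l + m) * m ! * S1 (l + 1) (m + 1) := by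
  simp [logPowDiv, logPoly_eval_zero]

theorem logPowDiv_ofReal (m : ℕ) {y : ℝ} (hy : 0 ≤ y) :
    logPowDiv m 0 y = ((Real.log y ^ m / y : ℝ) : ℂ) := by
  simp [logPowDiv, logPoly, Complex.ofReal_log hy]

theorem norm_log_pow_le (k : ℕ) {z : ℂ} (hz : 1 / 2 ≤ z.re) :
    ‖Complex.log z‖ ^ k ≤ 4 * Real.exp π * k ! * ‖z‖ := by
  have hz1 : 1 / 2 ≤ ‖z‖ := hz.trans (Complex.re_le_norm z)
  have hn : ‖Complex.log z‖ ≤ |Real.log ‖z‖| + π := by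
    refine (Complex.norm_le_abs_re_add_abs_im _).trans ?_
    rw [Complex.log_re, Complex.log_im]
    gcongr
    exact Complex.abs_arg_le_pi z
  have h1 : ‖Complex.log z‖ ^ k ≤ k ! * Real.exp ‖Complex.log z‖ := by
    have := Real.pow_div_factorial_le_exp ‖Complex.log z‖ (norm_nonneg _) k
    rwa [div_le_iff₀' (by positivity)] at this
  have h2 : Real.exp |Real.log ‖z‖| ≤ 4 * ‖z‖ := by
    have hp : 0 < ‖z‖ := by linarith
    rcases abs_cases (Real.log ‖z‖) with ⟨h, -⟩ | ⟨h, -⟩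
    · rw [h, Real.exp_log hp]; linarith
    · rw [h, Real.exp_neg, Real.exp_log hp, inv_le_iff_one_le_mul₀ hp]; nlinarith
  calc ‖Complex.log z‖ ^ k ≤ k ! * Real.exp (|Real.log ‖z‖| + π) := h1.trans (by gcongr)
    _ = k ! * (Real.exp |Real.log ‖z‖| * Real.exp π) := by rw [Real.exp_add]
    _ ≤ k ! * ((4 * ‖z‖) * Real.exp π) := by gcongr
    _ = _ := by ring

theorem exists_norm_eval_log_le (p : Polynomial ℂ) :
    ∃ C, 0 ≤ C ∧ ∀ z : ℂ, 1 / 2 ≤ z.re → ‖p.eval (Complex.log z)‖ ≤ C * ‖z‖ := by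
  refine ⟨∑ k ∈ range (p.natDegree + 1), ‖p.coeff k‖ * (4 * Real.exp π * k !),
    by positivity, fun z hz => ?_⟩
  rw [Polynomial.eval_eq_sum_range, Finset.sum_mul]
  refine (norm_sum_le _ _).trans (Finset.sum_le_sum fun k _ => ?_)
  rw [norm_mul, norm_pow, mul_assoc]
  gcongr
  exact norm_log_pow_le k hz

theorem exists_norm_logPowDiv_zero_le (m : ℕ) :
    ∃ C, 0 ≤ C ∧ ∀ z : ℂ, 1 / 2 ≤ z.re → ‖logPowDiv m 0 z‖ ≤ C := by
  obtain ⟨C, hC, h⟩ := exists_norm_eval_log_le (logPoly m 0)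
  refine ⟨C, hC, fun z hz => ?_⟩
  have hp : 0 < ‖z‖ := by linarith [hz.trans (Complex.re_le_norm z)]
  rw [logPowDiv, norm_div, norm_pow, zero_add, pow_one, div_le_iff₀ hp]
  exact h z hz

theorem mem_slitPlane_of_half_le {z : ℂ} (hz : 1 / 2 ≤ z.re) : z ∈ Complex.slitPlane :=
  Or.inl (by linarith)

theorem exists_abs_im_logPowDiv_le (m : ℕ) :
    ∃ C, 0 ≤ C ∧ ∀ a x : ℝ, 1 ≤ a → 0 ≤ x →
      |(logPowDiv m 0 (a + x * Complex.I)).im| ≤ C / a * x := by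
  obtain ⟨C, hC, h⟩ := exists_norm_eval_log_le (logPoly m 1)
  refine ⟨C, hC, fun a x ha hx => ?_⟩
  have hmv := (convex_halfSpace_re_ge a).norm_image_sub_le_of_norm_hasDerivWithin_le
    (f := logPowDiv m 0) (f' := logPowDiv m 1) (C := C / a) (x := (a : ℂ))
    (y := a + x * Complex.I)
    (fun z hz => (hasDerivAt_logPowDiv m 0
      (mem_slitPlane_of_half_le (by have : a ≤ z.re := hz; linarith))).hasDerivWithinAt)
    (fun z hz => ?_) (by simp) (by simp)
  · have h0 : (logPowDiv m 0 (a : ℂ)).im = 0 := by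
      rw [logPowDiv_ofReal m (by linarith)]; exact Complex.ofReal_im _
    have := (Complex.abs_im_le_norm _).trans hmv
    simpa [h0, abs_of_nonneg hx] using this
  · have hz' : a ≤ z.re := hz
    have hn : a ≤ ‖z‖ := hz'.trans (Complex.re_le_norm z)
    have hp : 0 < ‖z‖ := by linarith
    rw [logPowDiv, norm_div, norm_pow, div_le_div_iff₀ (by positivity) (by linarith)]
    have := h z (by linarith)
    calc _ ≤ (C * ‖z‖) * ‖z‖ := by gcongr
      _ = _ := by ring

end LogPow

section Taylor

open MeasureTheory

theorem fourierCoeffOn_circleMap {f : ℂ → ℂ} {r : ℝ} (hr : 0 < r)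
    (hf : DifferentiableOn ℂ f (Metric.closedBall 0 r)) (n : ℕ) :
    fourierCoeffOn Real.two_pi_pos (fun θ => f (circleMap 0 r θ)) n =
      r ^ n * (iteratedDeriv n f 0 / n !) := by
  have hc := hf.circleIntegral_one_div_sub_center_pow_smul hr n
  have hr0 : (r : ℂ) ≠ 0 := by exact_mod_cast hr.ne'
  have hpi : (π : ℂ) ≠ 0 := by exact_mod_cast Real.pi_ne_zero
  have hinteg : (∮ z in C(0, r), (1 / (z - 0) ^ (n + 1)) • f z) =
      Complex.I * ((r : ℂ) ^ n)⁻¹ * ∫ θ in (0 : ℝ)..2 * π,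
        fourier (-(n : ℤ)) (θ : AddCircle (2 * π - 0)) • f (circleMap 0 r θ) := by
    rw [circleIntegral, ← intervalIntegral.integral_const_mul]
    refine intervalIntegral.integral_congr fun θ _ => ?_
    have hexp : fourier (-(n : ℤ)) (θ : AddCircle (2 * π - 0)) =
        (Complex.exp (θ * Complex.I) ^ n)⁻¹ := by
      rw [fourier_coe_apply, ← Complex.exp_nat_mul, ← Complex.exp_neg]
      congr 1
      push_cast
      field_simp
      ring
    have he := Complex.exp_ne_zero (θ * Complex.I)
    simp only [deriv_circleMap, hexp, smul_eq_mul, sub_zero]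
    simp only [circleMap, zero_add]
    field_simp
    ring
  rw [hinteg, smul_eq_mul] at hc
  rw [fourierCoeffOn_eq_integral, Complex.real_smul]
  have hI := Complex.I_ne_zero
  have hn : (n ! : ℂ) ≠ 0 := by exact_mod_cast n.factorial_ne_zero
  have hrn : (r : ℂ) ^ n ≠ 0 := pow_ne_zero _ hr0
  field_simp at hc
  push_cast
  field_simp
  simpa [mul_comm, mul_left_comm, mul_assoc] using hc

theorem summable_norm_sq_taylorCoeff {f : ℂ → ℂ} {M : ℝ}
    (hf : DifferentiableOn ℂ f (Metric.ball 0 1)) (hM : ∀ z ∈ Metric.ball (0 : ℂ) 1, ‖f z‖ ≤ M) :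
    Summable fun n : ℕ => ‖iteratedDeriv n f 0 / (n !)‖ ^ 2 := by
  refine summable_of_sum_range_le (c := M ^ 2) (fun n => by positivity) fun N => ?_
  have key : ∀ r ∈ Set.Ioo (0 : ℝ) 1,
      ∑ n ∈ range N, (r ^ n * ‖iteratedDeriv n f 0 / (n !)‖) ^ 2 ≤ M ^ 2 := by
    intro r hr
    have hsub : Metric.closedBall (0 : ℂ) r ⊆ Metric.ball 0 1 :=
      Metric.closedBall_subset_ball hr.2
    have hmem : ∀ θ, circleMap 0 r θ ∈ Metric.ball (0 : ℂ) 1 := fun θ =>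
      hsub (circleMap_mem_closedBall 0 hr.1.le θ)
    have hcont : Continuous fun θ => f (circleMap 0 r θ) :=
      hf.continuousOn.comp_continuous (continuous_circleMap 0 r) hmem
    have hL2 : MemLp (fun θ => f (circleMap 0 r θ)) 2
        (volume.restrict (Set.Ioc 0 (2 * π))) :=
      MemLp.of_bound hcont.aestronglyMeasurable M (ae_of_all _ fun θ => hM _ (hmem θ))
    have hs := hasSum_sq_fourierCoeffOn Real.two_pi_pos hL2
    have h1 : ∑ n ∈ range N, (r ^ n * ‖iteratedDeriv n f 0 / (n !)‖) ^ 2 =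
        ∑ i ∈ (range N).map (Nat.castEmbedding : ℕ ↪ ℤ),
          ‖fourierCoeffOn Real.two_pi_pos (fun θ => f (circleMap 0 r θ)) i‖ ^ 2 := by
      rw [Finset.sum_map]
      refine Finset.sum_congr rfl fun n _ => ?_
      rw [Nat.castEmbedding_apply, fourierCoeffOn_circleMap hr.1 (hf.mono hsub), norm_mul, norm_pow,
        Complex.norm_real, Real.norm_of_nonneg hr.1.le]
    rw [h1]
    refine (sum_le_hasSum _ (fun _ _ => by positivity) hs).trans ?_
    have hb : ∫ θ in (0 : ℝ)..2 * π, ‖f (circleMap 0 r θ)‖ ^ 2 ≤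
        ∫ θ in (0 : ℝ)..2 * π, M ^ 2 := by
      refine intervalIntegral.integral_mono_on Real.two_pi_pos.le
        ((hcont.norm.pow 2).intervalIntegrable _ _)
        intervalIntegrable_const fun θ _ => ?_
      gcongr
      exact hM _ (hmem θ)
    rw [intervalIntegral.integral_const, smul_eq_mul] at hb
    rw [smul_eq_mul, inv_mul_le_iff₀ (by simpa using Real.pi_pos)]
    exact hb
  have hlim : Tendsto (fun r : ℝ => ∑ n ∈ range N, (r ^ n * ‖iteratedDeriv n f 0 / (n !)‖) ^ 2)
      (𝓝[<] 1) (𝓝 (∑ n ∈ range N, (1 ^ n * ‖iteratedDeriv n f 0 / (n !)‖) ^ 2)) :=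
    ((by fun_prop : Continuous fun r : ℝ => ∑ n ∈ range N,
      (r ^ n * ‖iteratedDeriv n f 0 / (n !)‖) ^ 2).tendsto 1).mono_left nhdsWithin_le_nhds
  have := le_of_tendsto hlim (Filter.eventually_of_mem
    (Ioo_mem_nhdsLT (zero_lt_one' ℝ)) key)
  simpa using this

theorem summable_norm_taylorCoeff_div {f : ℂ → ℂ} {M : ℝ}
    (hf : DifferentiableOn ℂ f (Metric.ball 0 1)) (hM : ∀ z ∈ Metric.ball (0 : ℂ) 1, ‖f z‖ ≤ M) :
    Summable fun n : ℕ => ‖iteratedDeriv (n + 1) f 0 / ((n + 1)!)‖ / (n + 1) := by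
  have h1 : Summable fun n : ℕ => ‖iteratedDeriv (n + 1) f 0 / ((n + 1)!)‖ ^ 2 :=
    (summable_norm_sq_taylorCoeff hf hM).comp_injective (add_left_injective 1)
  have h2 : Summable fun n : ℕ => 1 / ((n + 1 : ℕ) : ℝ) ^ 2 :=
    (Real.summable_one_div_nat_pow.2 one_lt_two).comp_injective (add_left_injective 1)
  refine Summable.of_nonneg_of_le (fun n => by positivity) (fun n => ?_) (h1.add h2)
  set c := ‖iteratedDeriv (n + 1) f 0 / ((n + 1)!)‖
  have := sq_nonneg (c - 1 / (n + 1 : ℝ))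
  have h3 : 0 ≤ c / (n + 1 : ℝ) := by positivity
  have h4 : c * (1 / (n + 1 : ℝ)) = c / (n + 1) := by ring
  push_cast
  have h5 : 1 / (n + 1 : ℝ) ^ 2 = (1 / (n + 1 : ℝ)) ^ 2 := by rw [div_pow, one_pow]
  rw [h5]
  nlinarith

theorem iteratedDeriv_eqOn_of_hasDerivAt {s : Set ℂ} (hs : IsOpen s) {G : ℕ → ℂ → ℂ}
    (hG : ∀ n, ∀ z ∈ s, HasDerivAt (G n) (G (n + 1) z) z) (n : ℕ) :
    Set.EqOn (iteratedDeriv n (G 0)) (G n) s := by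
  induction n with
  | zero => intro z _; simp
  | succ n ih =>
    intro z hz
    rw [iteratedDeriv_succ]
    exact ((hG n z hz).congr_of_eventuallyEq (ih.eventuallyEq_of_mem (hs.mem_nhds hz))).deriv

end Taylor

section Substitution

/-- The disc maps into the half-plane `Re z > 1 / 2` by `u ↦ 1 - i log (1 - u) / (2π)`. -/
noncomputable def logShift (u : ℂ) : ℂ := 1 + Complex.I / (2 * π) * -Complex.log (1 - u)

theorem one_sub_mem_slitPlane {u : ℂ} (hu : u ∈ Metric.ball (0 : ℂ) 1) :
    1 - u ∈ Complex.slitPlane := by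
  left
  have h1 : ‖u‖ < 1 := by simpa using hu
  have := (Complex.re_le_norm u).trans_lt h1
  simpa using this

theorem half_le_logShift_re (u : ℂ) : 1 / 2 ≤ (logShift u).re := by
  have h : (logShift u).re = 1 + (1 - u).arg / (2 * π) := by
    have : Complex.I / (2 * π) = ((1 / (2 * π) : ℝ) : ℂ) * Complex.I := by push_cast; ring
    rw [logShift, this, mul_assoc, Complex.add_re, Complex.re_ofReal_mul]
    simp [Complex.log_im]
    ring
  rw [h]
  have h1 := Complex.neg_pi_lt_arg (1 - u)
  have : -(1 / 2 : ℝ) ≤ (1 - u).arg / (2 * π) := by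
    rw [le_div_iff₀ (by positivity)]; linarith
  linarith

theorem logShift_ofReal (x : ℝ) :
    logShift ((1 - Real.exp (-(2 * π * x)) : ℝ) : ℂ) = ((1 : ℝ) : ℂ) + x * Complex.I := by
  have h : (1 : ℂ) - ((1 - Real.exp (-(2 * π * x)) : ℝ) : ℂ) =
      ((Real.exp (-(2 * π * x)) : ℝ) : ℂ) := by push_cast; ring
  rw [logShift, h, ← Complex.ofReal_log (Real.exp_pos _).le, Real.log_exp]
  have hpi : (π : ℂ) ≠ 0 := by exact_mod_cast Real.pi_ne_zero
  push_cast
  field_simp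

theorem hasDerivAt_logShift {u : ℂ} (hu : u ∈ Metric.ball (0 : ℂ) 1) :
    HasDerivAt logShift (Complex.I / (2 * π) * (1 - u)⁻¹) u := by
  have h1 : HasDerivAt (fun u : ℂ => 1 - u) (-1) u := by
    simpa using (hasDerivAt_id u).const_sub 1
  have h := ((h1.clog (one_sub_mem_slitPlane hu)).neg.const_mul (Complex.I / (2 * π))).const_add 1
  refine h.congr_deriv ?_
  rw [neg_div, neg_neg, one_div]

/-- The derivatives of `u ↦ logPowDiv m 0 (logShift u)`. -/
noncomputable def shiftedDeriv (m n : ℕ) (u : ℂ) : ℂ :=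
  ((1 - u) ^ n)⁻¹ * ∑ l ∈ range (n + 1),
    S1 n l * ((Complex.I / (2 * π)) ^ l * logPowDiv m l (logShift u))

theorem sum_S1_succ (n : ℕ) (g : ℕ → ℂ) :
    ∑ l ∈ range (n + 2), S1 (n + 1) l * g l =
      n * ∑ l ∈ range (n + 1), S1 n l * g l + ∑ l ∈ range (n + 1), S1 n l * g (l + 1) := by
  have h0 : (n : ℂ) * S1 n 0 = 0 := by exact_mod_cast S1_zero_right n
  have h1 : ∑ l ∈ range (n + 1), (S1 n (l + 1) : ℂ) * g (l + 1) =
      ∑ l ∈ range n, (S1 n (l + 1) : ℂ) * g (l + 1) := by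
    rw [Finset.sum_range_succ, S1_eq_zero_of_lt (Nat.lt_succ_self n)]; simp
  rw [Finset.sum_range_succ', S1_succ_zero, Finset.sum_range_succ' (fun l => (S1 n l : ℂ) * g l),
    ← h1, mul_add, ← mul_assoc, h0, Finset.mul_sum, Nat.cast_zero, zero_mul, add_zero,
    add_zero, ← Finset.sum_add_distrib]
  refine Finset.sum_congr rfl fun l _ => ?_
  rw [S1_succ_succ]
  push_cast
  ring

theorem hasDerivAt_shiftedDeriv (m n : ℕ) {u : ℂ} (hu : u ∈ Metric.ball (0 : ℂ) 1) :
    HasDerivAt (shiftedDeriv m n) (shiftedDeriv m (n + 1) u) u := by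
  have hne := Complex.slitPlane_ne_zero (one_sub_mem_slitPlane hu)
  have h1 : HasDerivAt (fun u : ℂ => 1 - u) (-1) u := by
    simpa using (hasDerivAt_id u).const_sub 1
  have h2 := ((h1.fun_pow n).fun_inv (pow_ne_zero n hne))
  have h3 : HasDerivAt (fun u => ∑ l ∈ range (n + 1),
      S1 n l * ((Complex.I / (2 * π)) ^ l * logPowDiv m l (logShift u)))
      (∑ l ∈ range (n + 1), S1 n l * ((Complex.I / (2 * π)) ^ l *
        (logPowDiv m (l + 1) (logShift u) * (Complex.I / (2 * π) * (1 - u)⁻¹)))) u := by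
    refine HasDerivAt.fun_sum fun l _ => ?_
    exact (((hasDerivAt_logPowDiv m l (mem_slitPlane_of_half_le (half_le_logShift_re u))).comp u
      (hasDerivAt_logShift hu)).const_mul _).const_mul _
  refine (h2.mul h3).congr_deriv ?_
  rw [shiftedDeriv, sum_S1_succ]
  have h4 : (∑ l ∈ range (n + 1), (S1 n l : ℂ) * ((Complex.I / (2 * π)) ^ l *
        (logPowDiv m (l + 1) (logShift u) * (Complex.I / (2 * π) * (1 - u)⁻¹)))) =
      (1 - u)⁻¹ * ∑ l ∈ range (n + 1), (S1 n l : ℂ) * ((Complex.I / (2 * π)) ^ (l + 1) *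
        logPowDiv m (l + 1) (logShift u)) := by
    rw [Finset.mul_sum]
    refine Finset.sum_congr rfl fun l _ => ?_
    rw [pow_succ]; ring
  rw [h4]
  rcases n with _ | n
  · simp
  · rw [Nat.add_sub_cancel]
    field_simp
    ring

theorem shiftedDeriv_zero_index (m : ℕ) :
    shiftedDeriv m 0 = fun u => logPowDiv m 0 (logShift u) := by
  funext u
  simp [shiftedDeriv, S1]

/-- The Taylor coefficients at `0` of `u ↦ logPowDiv m 0 (logShift u)`. -/
noncomputable def shiftCoeff (m n : ℕ) : ℂ :=
  (∑ l ∈ range (n + 1), S1 n l * ((Complex.I / (2 * π)) ^ l * logPowDiv m l 1)) / n !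

theorem iteratedDeriv_shiftedDeriv (m n : ℕ) :
    iteratedDeriv n (shiftedDeriv m 0) 0 / n ! = shiftCoeff m n := by
  rw [iteratedDeriv_eqOn_of_hasDerivAt Metric.isOpen_ball
    (fun n z hz => hasDerivAt_shiftedDeriv m n hz) n (Metric.mem_ball_self one_pos)]
  simp [shiftedDeriv, shiftCoeff, logShift]

theorem differentiableOn_shiftedDeriv (m : ℕ) :
    DifferentiableOn ℂ (shiftedDeriv m 0) (Metric.ball 0 1) := fun _ hz =>
  (hasDerivAt_shiftedDeriv m 0 hz).differentiableAt.differentiableWithinAt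

theorem hasSum_shiftCoeff (m : ℕ) {u : ℂ} (hu : u ∈ Metric.ball (0 : ℂ) 1) :
    HasSum (fun n => shiftCoeff m n * u ^ n) (logPowDiv m 0 (logShift u)) := by
  have h := Complex.hasSum_taylorSeries_on_ball (differentiableOn_shiftedDeriv m) hu
  rw [shiftedDeriv_zero_index] at h
  refine h.congr_fun fun n => ?_
  rw [← iteratedDeriv_shiftedDeriv, shiftedDeriv_zero_index, sub_zero, smul_eq_mul, smul_eq_mul]
  ring

theorem summable_norm_shiftCoeff_div (m : ℕ) :
    Summable fun n : ℕ => ‖shiftCoeff m (n + 1)‖ / (n + 1) := by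
  obtain ⟨C, -, hC⟩ := exists_norm_logPowDiv_zero_le m
  have h := summable_norm_taylorCoeff_div (differentiableOn_shiftedDeriv m) (M := C)
    (fun z _ => by rw [shiftedDeriv_zero_index]; exact hC _ (half_le_logShift_re z))
  simpa only [iteratedDeriv_shiftedDeriv] using h

theorem shiftCoeff_im (m n : ℕ) :
    (shiftCoeff m n).im = -((-1) ^ m * m ! * ((1 / n !) * ∑ k ∈ range (n / 2 + 1),
      (-1 : ℝ) ^ k * S1 (2 * k + 2) (m + 1) * S1 n (2 * k + 1) / (2 * π) ^ (2 * k + 1))) := by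
  have hterm : ∀ l, ((S1 n l : ℂ) * ((Complex.I / (2 * π)) ^ l * logPowDiv m l 1)).im =
      S1 n l * (Complex.I ^ l).im * ((-1) ^ (l + m) * m ! * S1 (l + 1) (m + 1)) / (2 * π) ^ l := by
    intro l
    have : (S1 n l : ℂ) * ((Complex.I / (2 * π)) ^ l * logPowDiv m l 1) =
        ((S1 n l * ((-1) ^ (l + m) * m ! * S1 (l + 1) (m + 1)) / (2 * π) ^ l : ℝ) : ℂ) *
          Complex.I ^ l := by
      rw [logPowDiv_one]; push_cast; rw [div_pow]; ring
    rw [this, Complex.im_ofReal_mul]; ring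
  have hev : ∀ k, (Complex.I ^ (2 * k)).im = 0 := by
    intro k
    rw [pow_mul, Complex.I_sq]
    have : ((-1 : ℂ)) ^ k = (((-1 : ℝ) ^ k : ℝ) : ℂ) := by push_cast; rfl
    rw [this, Complex.ofReal_im]
  have hodd : ∀ k, (Complex.I ^ (2 * k + 1)).im = (-1) ^ k := by
    intro k
    rw [pow_succ, pow_mul, Complex.I_sq]
    have : ((-1 : ℂ)) ^ k = (((-1 : ℝ) ^ k : ℝ) : ℂ) := by push_cast; rfl
    rw [this, Complex.im_ofReal_mul, Complex.I_im, mul_one]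
  have hsum : ∀ (N : ℕ) (g : ℕ → ℝ), ∑ l ∈ range (2 * N), g l =
      ∑ k ∈ range N, (g (2 * k) + g (2 * k + 1)) := by
    intro N g
    induction N with
    | zero => simp
    | succ N ih => rw [mul_add, mul_one, Finset.sum_range_succ, Finset.sum_range_succ, ih,
        Finset.sum_range_succ]; ring
  have hext : ∑ l ∈ range (n + 1), ((S1 n l : ℂ) * ((Complex.I / (2 * π)) ^ l * logPowDiv m l 1)) =
      ∑ l ∈ range (2 * (n / 2 + 1)),
        ((S1 n l : ℂ) * ((Complex.I / (2 * π)) ^ l * logPowDiv m l 1)) := by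
    refine Finset.sum_subset (Finset.range_subset_range.2 (by omega)) fun l _ hl => ?_
    rw [S1_eq_zero_of_lt (by simpa using hl)]; simp
  rw [shiftCoeff, hext, Complex.div_natCast_im, Complex.im_sum, hsum]
  simp only [hterm, hev, hodd]
  rw [Finset.mul_sum, Finset.mul_sum, ← Finset.sum_neg_distrib, Finset.sum_div]
  refine Finset.sum_congr rfl fun k _ => ?_
  have : ((-1 : ℝ)) ^ (2 * k + 1 + m) = -(-1) ^ m := by
    rw [pow_add, pow_succ, pow_mul]; simp
  rw [this]
  ring

end Substitution

section TrapezoidalFourier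

open MeasureTheory

theorem hasSum_cos_div_sq {x : ℝ} (hx : x ∈ Set.Icc (0 : ℝ) 1) :
    HasSum (fun j : ℕ => Real.cos (2 * π * (j + 1) * x) / (2 * π * (j + 1)) ^ 2)
      ((x ^ 2 - x + 1 / 6) / 4) := by
  have h := hasSum_one_div_nat_pow_mul_cos one_ne_zero hx
  have hB : (Polynomial.map (algebraMap ℚ ℝ) (Polynomial.bernoulli 2)).eval x =
      x ^ 2 - x + 1 / 6 := by
    simp only [Polynomial.bernoulli, Finset.sum_range_succ, Polynomial.map_add,
      Polynomial.map_monomial, Polynomial.eval_add, Polynomial.eval_monomial]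
    norm_num [bernoulli_one, bernoulli_two, Nat.choose]
    ring
  rw [mul_one, hB, ← hasSum_nat_add_iff' 1] at h
  have he : (x ^ 2 - x + 1 / 6) / 4 = 1 / (2 * π) ^ 2 * ((-1 : ℝ) ^ (1 + 1) * (2 * π) ^ 2 / 2 /
      (2 ! : ℕ) * (x ^ 2 - x + 1 / 6) -
      ∑ i ∈ range 1, 1 / (i : ℝ) ^ 2 * Real.cos (2 * π * i * x)) := by
    simp
    field_simp
    norm_num
  rw [he]
  refine (h.mul_left (1 / (2 * π) ^ 2)).congr_fun fun j => ?_
  push_cast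
  field_simp

theorem cos_sub_nat (j k : ℕ) (y : ℝ) :
    Real.cos (2 * π * (j + 1) * (y - k)) = Real.cos (2 * π * (j + 1) * y) := by
  rw [← Real.cos_sub_nat_mul_two_pi (2 * π * (j + 1) * y) ((j + 1) * k)]
  congr 1
  push_cast
  ring

theorem hasSum_integral_mul_cos {f f1 f2 : ℝ → ℝ} (k : ℕ)
    (h1 : ∀ y ∈ Set.Icc (k : ℝ) (k + 1), HasDerivAt f (f1 y) y)
    (h2 : ∀ y ∈ Set.Icc (k : ℝ) (k + 1), HasDerivAt f1 (f2 y) y)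
    (h3 : ContinuousOn f2 (Set.Icc (k : ℝ) (k + 1))) :
    HasSum (fun j : ℕ => ∫ y in (k : ℝ)..(k + 1), f y * Real.cos (2 * π * (j + 1) * y))
      (((f k + f (k + 1)) / 2 - ∫ y in (k : ℝ)..(k + 1), f y) / 2) := by
  have hle : (k : ℝ) ≤ k + 1 := by linarith
  have hI : Set.uIcc (k : ℝ) (k + 1) = Set.Icc (k : ℝ) (k + 1) := Set.uIcc_of_le hle
  have c1 : ContinuousOn f (Set.Icc (k : ℝ) (k + 1)) :=
    fun y hy => (h1 y hy).continuousAt.continuousWithinAt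
  have ii : ∀ {g : ℝ → ℝ}, ContinuousOn g (Set.Icc (k : ℝ) (k + 1)) →
      IntervalIntegrable g volume k (k + 1) := fun hg =>
    ContinuousOn.intervalIntegrable (by rwa [hI])
  have hsq : HasSum (fun j : ℕ => 1 / (2 * π * (j + 1 : ℝ)) ^ 2) (1 / 24) := by
    have := hasSum_cos_div_sq (x := 0) (by simp)
    norm_num at this ⊢
    simpa using this
  have hterm : ∀ j : ℕ, (∫ y in (k : ℝ)..(k + 1), f y * Real.cos (2 * π * (j + 1) * y)) =
      1 / (2 * π * (j + 1 : ℝ)) ^ 2 * (f1 (k + 1) - f1 k) -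
        ∫ y in (k : ℝ)..(k + 1),
          f2 y * (Real.cos (2 * π * (j + 1) * y) / (2 * π * (j + 1)) ^ 2) := by
    intro j
    set c : ℝ := 2 * π * (j + 1) with hc
    have hc0 : c ≠ 0 := by positivity
    have hcosk : Real.cos (c * k) = 1 := by
      have := Real.cos_nat_mul_two_pi ((j + 1) * k)
      refine Eq.trans ?_ this
      rw [hc]; push_cast; ring_nf
    have hsink : Real.sin (c * k) = 0 := by
      have := Real.sin_nat_mul_pi (2 * ((j + 1) * k))
      refine Eq.trans ?_ this
      rw [hc]; push_cast; ring_nf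
    have hcosk1 : Real.cos (c * (k + 1)) = 1 := by
      have := Real.cos_nat_mul_two_pi ((j + 1) * (k + 1))
      refine Eq.trans ?_ this
      rw [hc]; push_cast; ring_nf
    have hsink1 : Real.sin (c * (k + 1)) = 0 := by
      have := Real.sin_nat_mul_pi (2 * ((j + 1) * (k + 1)))
      refine Eq.trans ?_ this
      rw [hc]; push_cast; ring_nf
    have i1 : IntervalIntegrable (fun y => f y * Real.cos (c * y)) volume k (k + 1) :=
      ii (c1.mul (by fun_prop))
    have i2 : IntervalIntegrable (fun y => f2 y * (Real.cos (c * y) / c ^ 2)) volume k (k + 1) :=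
      ii (h3.mul (by fun_prop))
    have hF : ∀ y ∈ Set.uIcc (k : ℝ) (k + 1),
        HasDerivAt (fun y => f y * (Real.sin (c * y) / c) + f1 y * (Real.cos (c * y) / c ^ 2))
          (f y * Real.cos (c * y) + f2 y * (Real.cos (c * y) / c ^ 2)) y := by
      intro y hy
      rw [hI] at hy
      have hl : HasDerivAt (fun y => c * y) c y := by simpa using (hasDerivAt_id y).const_mul c
      refine (((h1 y hy).mul (hl.sin.div_const c)).add
        ((h2 y hy).mul (hl.cos.div_const (c ^ 2)))).congr_deriv ?_
      field_simp
      ring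
    have := intervalIntegral.integral_eq_sub_of_hasDerivAt hF (i1.add i2)
    rw [intervalIntegral.integral_add i1 i2] at this
    rw [hcosk, hcosk1, hsink, hsink1] at this
    linear_combination this
  have hsum : HasSum (fun j : ℕ => ∫ y in (k : ℝ)..(k + 1),
        f2 y * (Real.cos (2 * π * (j + 1) * y) / (2 * π * (j + 1)) ^ 2))
      (∫ y in (k : ℝ)..(k + 1), f2 y * (((y - k) ^ 2 - (y - k) + 1 / 6) / 4)) := by
    refine intervalIntegral.hasSum_integral_of_dominated_convergence
      (fun j y => |f2 y| * (1 / (2 * π * (j + 1 : ℝ)) ^ 2)) (fun j => ?_) (fun j => ?_)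
      ?_ ?_ ?_
    · exact (ii (h3.mul (by fun_prop))).aestronglyMeasurable_restrict_uIoc
    · refine ae_of_all _ fun y _ => ?_
      rw [Real.norm_eq_abs, abs_mul, abs_div, abs_of_nonneg (by positivity :
        (0 : ℝ) ≤ (2 * π * (j + 1)) ^ 2)]
      gcongr
      exact Real.abs_cos_le_one _
    · exact ae_of_all _ fun y _ => hsq.summable.mul_left _
    · simp_rw [tsum_mul_left]
      exact (ii h3.abs).mul_const _
    · refine ae_of_all _ fun y hy => ?_
      rw [Set.uIoc_of_le hle] at hy
      have := (hasSum_cos_div_sq (x := y - k)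
        ⟨by linarith [hy.1], by linarith [hy.2]⟩).mul_left (f2 y)
      simpa only [cos_sub_nat] using this
  have hback : (∫ y in (k : ℝ)..(k + 1), f2 y * (((y - k) ^ 2 - (y - k) + 1 / 6) / 4)) =
      (f1 (k + 1) - f1 k) / 24 - (f (k + 1) + f k) / 4 +
        (∫ y in (k : ℝ)..(k + 1), f y) / 2 := by
    have i2 : IntervalIntegrable (fun y => f2 y * (((y - k) ^ 2 - (y - k) + 1 / 6) / 4))
        volume k (k + 1) := ii (h3.mul (by fun_prop))
    have i1 : IntervalIntegrable (fun y => f y / 2) volume k (k + 1) := ii (c1.div_const 2)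
    have hF : ∀ y ∈ Set.uIcc (k : ℝ) (k + 1),
        HasDerivAt (fun y => f1 y * (((y - k) ^ 2 - (y - k) + 1 / 6) / 4) -
          f y * ((2 * (y - k) - 1) / 4))
          (f2 y * (((y - k) ^ 2 - (y - k) + 1 / 6) / 4) - f y / 2) y := by
      intro y hy
      rw [hI] at hy
      have hl : HasDerivAt (fun y : ℝ => y - k) 1 y := (hasDerivAt_id y).sub_const _
      refine (((h2 y hy).mul ((((hl.fun_pow 2).fun_sub hl).add_const (1 / 6)).div_const 4)).sub
        ((h1 y hy).mul (((hl.const_mul 2).sub_const 1).div_const 4))).congr_deriv ?_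
      simp
      ring
    have := intervalIntegral.integral_eq_sub_of_hasDerivAt hF (i2.sub i1)
    rw [intervalIntegral.integral_sub i2 i1, intervalIntegral.integral_div] at this
    linear_combination this
  have := (hsq.mul_right (f1 (k + 1) - f1 k)).sub hsum
  rw [hback] at this
  simp_rw [hterm]
  have he : ((f k + f (k + 1)) / 2 - ∫ y in (k : ℝ)..(k + 1), f y) / 2 =
      1 / 24 * (f1 (k + 1) - f1 k) - ((f1 (k + 1) - f1 k) / 24 - (f (k + 1) + f k) / 4 +
        (∫ y in (k : ℝ)..(k + 1), f y) / 2) := by ring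
  rw [he]
  exact this

end TrapezoidalFourier

section AbelPlana

open MeasureTheory

theorem integral_id_mul_exp_neg {c : ℝ} (hc : 0 < c) :
    IntegrableOn (fun x : ℝ => x * Real.exp (-(c * x))) (Set.Ioi 0) ∧
      ∫ x in Set.Ioi (0 : ℝ), x * Real.exp (-(c * x)) = 1 / c ^ 2 := by
  have hF : ∀ x ∈ Set.Ici (0 : ℝ), HasDerivAt
      (fun x => -(x / c) * Real.exp (-(c * x)) - Real.exp (-(c * x)) / c ^ 2)
      (x * Real.exp (-(c * x))) x := by
    intro x _
    have hl : HasDerivAt (fun x => -(c * x)) (-c) x := by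
      simpa using ((hasDerivAt_id x).const_mul c).fun_neg
    refine ((((hasDerivAt_id x).div_const c).neg.mul hl.exp).sub
      (hl.exp.div_const (c ^ 2))).congr_deriv ?_
    simp
    field_simp
    ring
  have hpos : ∀ x ∈ Set.Ioi (0 : ℝ), 0 ≤ x * Real.exp (-(c * x)) := fun x hx =>
    mul_nonneg (le_of_lt hx) (Real.exp_pos _).le
  have hlim : Tendsto (fun x => -(x / c) * Real.exp (-(c * x)) - Real.exp (-(c * x)) / c ^ 2)
      atTop (𝓝 0) := by
    have hcx : Tendsto (fun x : ℝ => c * x) atTop atTop := tendsto_id.const_mul_atTop hc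
    have h1 := (Real.tendsto_pow_mul_exp_neg_atTop_nhds_zero 1).comp hcx
    have h0 := (Real.tendsto_pow_mul_exp_neg_atTop_nhds_zero 0).comp hcx
    have := (h1.const_mul (-(1 / c ^ 2))).sub (h0.div_const (c ^ 2))
    simp only [Function.comp_def, pow_one, pow_zero, one_mul, mul_zero, zero_div, sub_zero] at this
    refine this.congr fun x => ?_
    field_simp
  refine ⟨integrableOn_Ioi_deriv_of_nonneg' hF hpos hlim, ?_⟩
  rw [integral_Ioi_of_hasDerivAt_of_nonneg' hF hpos hlim]
  simp

theorem hasSum_exp_neg_two_pi {x : ℝ} (hx : 0 < x) :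
    HasSum (fun j : ℕ => Real.exp (-(2 * π * (j + 1) * x))) (1 / (Real.exp (2 * π * x) - 1)) := by
  have h1 : Real.exp (-(2 * π * x)) < 1 := by
    rw [Real.exp_lt_one_iff]; simp; positivity
  have h := (hasSum_geometric_of_lt_one (Real.exp_pos _).le h1).mul_left (Real.exp (-(2 * π * x)))
  have he : 1 / (Real.exp (2 * π * x) - 1) =
      Real.exp (-(2 * π * x)) * (1 - Real.exp (-(2 * π * x)))⁻¹ := by
    rw [Real.exp_neg] at h1 ⊢
    have : Real.exp (2 * π * x) - 1 ≠ 0 := by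
      have := Real.add_one_lt_exp (x := 2 * π * x) (by positivity)
      have : 0 < 2 * π * x := by positivity
      linarith
    field_simp
  rw [he]
  refine h.congr_fun fun j => ?_
  rw [← Real.exp_nat_mul, ← Real.exp_add]
  congr 1
  ring

theorem hasSum_integral_mul_exp_neg {h : ℝ → ℝ} {B : ℝ} (hh : Continuous h)
    (hB : ∀ x, 0 ≤ x → |h x| ≤ B * x) :
    HasSum (fun j : ℕ => ∫ x in Set.Ioi (0 : ℝ), h x * Real.exp (-(2 * π * (j + 1) * x)))
        (∫ x in Set.Ioi (0 : ℝ), h x * (1 / (Real.exp (2 * π * x) - 1))) ∧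
      |∫ x in Set.Ioi (0 : ℝ), h x * (1 / (Real.exp (2 * π * x) - 1))| ≤ B / 24 := by
  have hsq : HasSum (fun j : ℕ => 1 / (2 * π * (j + 1 : ℝ)) ^ 2) (1 / 24) := by
    have := hasSum_cos_div_sq (x := 0) (by simp)
    norm_num at this ⊢
    simpa using this
  have hc : ∀ j : ℕ, 0 < 2 * π * (j + 1 : ℝ) := fun j => by positivity
  have hle : ∀ (j : ℕ), ∀ x ∈ Set.Ioi (0 : ℝ), ‖h x * Real.exp (-(2 * π * (j + 1) * x))‖ ≤
      B * (x * Real.exp (-(2 * π * (j + 1) * x))) := by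
    intro j x hx
    rw [norm_mul, Real.norm_eq_abs, Real.norm_eq_abs, Real.abs_exp, ← mul_assoc]
    gcongr
    exact hB x (le_of_lt hx)
  have hinteg : ∀ j : ℕ, IntegrableOn (fun x => h x * Real.exp (-(2 * π * (j + 1) * x)))
      (Set.Ioi 0) := fun j =>
    Integrable.mono' ((integral_id_mul_exp_neg (hc j)).1.const_mul B)
      (by fun_prop : Continuous _).aestronglyMeasurable
      ((ae_restrict_iff' measurableSet_Ioi).2 (ae_of_all _ (hle j)))
  have hbound : ∀ j : ℕ, ∫ x in Set.Ioi (0 : ℝ), ‖h x * Real.exp (-(2 * π * (j + 1) * x))‖ ≤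
      B * (1 / (2 * π * (j + 1 : ℝ)) ^ 2) := by
    intro j
    rw [← (integral_id_mul_exp_neg (hc j)).2, ← integral_const_mul]
    exact setIntegral_mono_on (hinteg j).norm ((integral_id_mul_exp_neg (hc j)).1.const_mul B)
      measurableSet_Ioi (hle j)
  have hsumm : Summable fun j : ℕ =>
      ∫ x in Set.Ioi (0 : ℝ), ‖h x * Real.exp (-(2 * π * (j + 1) * x))‖ :=
    Summable.of_nonneg_of_le (fun j => integral_nonneg fun _ => norm_nonneg _) hbound
      (hsq.summable.mul_left B)
  have hS := hasSum_integral_of_summable_integral_norm hinteg hsumm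
  have heq : (∫ x in Set.Ioi (0 : ℝ), ∑' j : ℕ, h x * Real.exp (-(2 * π * (j + 1) * x))) =
      ∫ x in Set.Ioi (0 : ℝ), h x * (1 / (Real.exp (2 * π * x) - 1)) :=
    setIntegral_congr_fun measurableSet_Ioi fun x hx =>
      ((hasSum_exp_neg_two_pi hx).mul_left (h x)).tsum_eq
  rw [heq] at hS
  refine ⟨hS, ?_⟩
  rw [← hS.tsum_eq, ← Real.norm_eq_abs]
  have := tsum_of_norm_bounded (hsq.mul_left B)
    (fun j => (norm_integral_le_integral_norm _).trans (hbound j))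
  simpa [div_eq_mul_inv] using this

end AbelPlana

section LogPowAbelPlana

open MeasureTheory

theorem half_le_re_add_mul_I {a : ℝ} (ha : 1 ≤ a) (x : ℝ) :
    1 / 2 ≤ ((a : ℂ) + x * Complex.I).re := by
  simp; linarith

theorem continuous_im_logPowDiv (m : ℕ) {a : ℝ} (ha : 1 ≤ a) :
    Continuous fun x : ℝ => (logPowDiv m 0 (a + x * Complex.I)).im := by
  refine Complex.continuous_im.comp (continuous_iff_continuousAt.2 fun x => ?_)
  exact ContinuousAt.comp (f := fun x : ℝ => (a : ℂ) + x * Complex.I) (hasDerivAt_logPowDiv m 0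
    (mem_slitPlane_of_half_le (half_le_re_add_mul_I ha x))).continuousAt
    (by fun_prop : Continuous fun x : ℝ => (a : ℂ) + x * Complex.I).continuousAt

theorem integrableOn_im_logPowDiv_mul_exp (m : ℕ) {a c : ℝ} (ha : 1 ≤ a) (hc : 0 < c) :
    IntegrableOn (fun x : ℝ => (logPowDiv m 0 (a + x * Complex.I)).im * Real.exp (-(c * x)))
      (Set.Ioi 0) := by
  obtain ⟨C, -, hC⟩ := exists_abs_im_logPowDiv_le m
  refine Integrable.mono' ((integral_id_mul_exp_neg hc).1.const_mul (C / a))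
    ((continuous_im_logPowDiv m ha).mul (by fun_prop)).aestronglyMeasurable
    ((ae_restrict_iff' measurableSet_Ioi).2 (ae_of_all _ fun x hx => ?_))
  rw [norm_mul, Real.norm_eq_abs, Real.norm_eq_abs, Real.abs_exp, ← mul_assoc]
  gcongr
  exact hC a x ha (le_of_lt hx)

theorem exp_I_mul_nat_add (j k : ℕ) (x : ℝ) :
    Complex.exp (Complex.I * (2 * π * (j + 1)) * (k + x * Complex.I)) =
      (Real.exp (-(2 * π * (j + 1) * x)) : ℝ) := by
  have : Complex.I * (2 * π * (j + 1)) * (k + x * Complex.I) =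
      ((-(2 * π * (j + 1) * x) : ℝ) : ℂ) + ((j + 1) * k : ℕ) * (2 * π * Complex.I) := by
    push_cast
    linear_combination (2 * π * (j + 1) * x : ℂ) * Complex.I_sq
  rw [this, Complex.exp_add, Complex.exp_nat_mul_two_pi_mul_I, mul_one, Complex.ofReal_exp]

theorem integral_logPow_mul_cos (m j k : ℕ) (hk : 1 ≤ k) :
    (∫ y in (k : ℝ)..(k + 1), Real.log y ^ m / y * Real.cos (2 * π * (j + 1) * y)) =
      (∫ x in Set.Ioi (0 : ℝ), (logPowDiv m 0 (((k + 1 : ℕ) : ℝ) + x * Complex.I)).im *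
        Real.exp (-(2 * π * (j + 1) * x))) -
      ∫ x in Set.Ioi (0 : ℝ), (logPowDiv m 0 ((k : ℝ) + x * Complex.I)).im *
        Real.exp (-(2 * π * (j + 1) * x)) := by
  have hk1 : (1 : ℝ) ≤ k := by exact_mod_cast hk
  have hk2 : (1 : ℝ) ≤ ((k + 1 : ℕ) : ℝ) := by exact_mod_cast Nat.le_succ_of_le hk
  have hc : 0 < 2 * π * (j + 1 : ℝ) := by positivity
  obtain ⟨C, hC0, hC⟩ := exists_norm_logPowDiv_zero_le m
  set g : ℂ → ℂ := fun z =>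
    logPowDiv m 0 z * Complex.exp (Complex.I * (2 * π * (j + 1)) * z) with hg
  have hgd : ∀ z : ℂ, 1 / 2 ≤ z.re → DifferentiableAt ℂ g z := fun z hz =>
    (hasDerivAt_logPowDiv m 0 (mem_slitPlane_of_half_le hz)).differentiableAt.mul (by fun_prop)
  have hside : ∀ a : ℕ, (1 : ℝ) ≤ (a : ℝ) → ∀ x : ℝ,
      g ((a : ℝ) + x * Complex.I) = ((Real.exp (-(2 * π * (j + 1) * x)) : ℝ) : ℂ) *
        logPowDiv m 0 ((a : ℝ) + x * Complex.I) := by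
    intro a _ x
    simp only [hg]
    rw [mul_comm, Complex.ofReal_natCast, exp_I_mul_nat_add]
  have hsidec : ∀ a : ℕ, (1 : ℝ) ≤ (a : ℝ) →
      Continuous fun x : ℝ => g ((a : ℝ) + x * Complex.I) := by
    intro a ha
    refine continuous_iff_continuousAt.2 fun x => ?_
    exact ContinuousAt.comp (f := fun x : ℝ => ((a : ℝ) : ℂ) + x * Complex.I)
      (hgd _ (half_le_re_add_mul_I ha x)).continuousAt
      (by fun_prop : Continuous fun x : ℝ => ((a : ℝ) : ℂ) + x * Complex.I).continuousAt
  have hsideim : ∀ a : ℕ, (1 : ℝ) ≤ (a : ℝ) → ∀ R : ℝ,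
      (∫ x in (0 : ℝ)..R, g ((a : ℝ) + x * Complex.I)).im = ∫ x in (0 : ℝ)..R,
        (logPowDiv m 0 ((a : ℝ) + x * Complex.I)).im * Real.exp (-(2 * π * (j + 1) * x)) := by
    intro a ha R
    rw [← Complex.imCLM_apply, ← ContinuousLinearMap.intervalIntegral_comp_comm _
      ((hsidec a ha).intervalIntegrable _ _)]
    refine intervalIntegral.integral_congr fun x _ => ?_
    simp only [Complex.imCLM_apply]
    rw [hside a ha x, Complex.im_ofReal_mul, mul_comm]
  have hrect : ∀ R : ℝ, 0 ≤ R →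
      (∫ y in (k : ℝ)..(k + 1), Real.log y ^ m / y * Real.cos (2 * π * (j + 1) * y)) =
      (∫ y in (k : ℝ)..(k + 1), g (y + R * Complex.I)).re +
      (∫ x in (0 : ℝ)..R, (logPowDiv m 0 (((k + 1 : ℕ) : ℝ) + x * Complex.I)).im *
        Real.exp (-(2 * π * (j + 1) * x))) -
      ∫ x in (0 : ℝ)..R, (logPowDiv m 0 ((k : ℝ) + x * Complex.I)).im *
        Real.exp (-(2 * π * (j + 1) * x)) := by
    intro R hR
    have hle : (k : ℝ) ≤ k + 1 := by linarith
    have h := Complex.integral_boundary_rect_eq_zero_of_differentiableOn g (k : ℝ)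
      (((k + 1 : ℕ) : ℝ) + R * Complex.I) (fun z hz => (hgd z (by
        have h1 := hz.1
        simp at h1
        linarith [h1.1])).differentiableWithinAt)
    have e1 : (((k + 1 : ℕ) : ℝ) + R * Complex.I : ℂ).re = ((k + 1 : ℕ) : ℝ) := by simp
    have e2 : (((k + 1 : ℕ) : ℝ) + R * Complex.I : ℂ).im = R := by simp
    rw [e1, e2, Complex.ofReal_re, Complex.ofReal_im] at h
    have hre := congrArg Complex.re h
    rw [Complex.sub_re, Complex.add_re, Complex.sub_re, smul_eq_mul, smul_eq_mul,
      Complex.I_mul_re, Complex.I_mul_re, hsideim _ hk2, hsideim _ hk1, Complex.zero_re] at hre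
    have hbot : (∫ y in (k : ℝ)..((k + 1 : ℕ) : ℝ), g (y + (0 : ℝ) * Complex.I)).re =
        ∫ y in (k : ℝ)..(k + 1),
          Real.log y ^ m / y * Real.cos (2 * π * (j + 1) * y) := by
      have hcont : ContinuousOn (fun y : ℝ => g (y + (0 : ℝ) * Complex.I))
          (Set.uIcc (k : ℝ) ((k + 1 : ℕ) : ℝ)) := by
        intro y hy
        push_cast at hy
        rw [Set.uIcc_of_le hle] at hy
        refine ContinuousAt.continuousWithinAt ?_
        exact ContinuousAt.comp (f := fun y : ℝ => (y : ℂ) + (0 : ℝ) * Complex.I)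
          (hgd _ (half_le_re_add_mul_I (by linarith [hy.1]) 0)).continuousAt
          (by fun_prop : Continuous fun y : ℝ => (y : ℂ) + (0 : ℝ) * Complex.I).continuousAt
      rw [← Complex.reCLM_apply, ← ContinuousLinearMap.intervalIntegral_comp_comm _
        hcont.intervalIntegrable, Nat.cast_succ]
      refine intervalIntegral.integral_congr fun y hy => ?_
      rw [Set.uIcc_of_le hle] at hy
      have he : Complex.I * (2 * π * (j + 1)) * (y : ℂ) =
          ((2 * π * (j + 1) * y : ℝ) : ℂ) * Complex.I := by push_cast; ring
      simp only [Complex.reCLM_apply, hg, Complex.ofReal_zero, zero_mul, add_zero]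
      rw [logPowDiv_ofReal m (by linarith [hy.1]), he, Complex.re_ofReal_mul,
        Complex.exp_ofReal_mul_I_re]
    rw [hbot, Nat.cast_succ] at hre
    rw [Nat.cast_succ]
    linarith
  have htop : Tendsto (fun R : ℝ => (∫ y in (k : ℝ)..(k + 1), g (y + R * Complex.I)).re)
      atTop (𝓝 0) := by
    have hexp : Tendsto (fun R : ℝ => C * Real.exp (-(2 * π * (j + 1) * R))) atTop (𝓝 0) := by
      have := Real.tendsto_exp_neg_atTop_nhds_zero.comp (tendsto_id.const_mul_atTop hc)
      simpa using this.const_mul C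
    refine squeeze_zero_norm (fun R => ?_) hexp
    refine (Complex.abs_re_le_norm _).trans ?_
    have := intervalIntegral.norm_integral_le_of_norm_le_const (a := (k : ℝ)) (b := k + 1)
      (f := fun y : ℝ => g (y + R * Complex.I))
      (C := C * Real.exp (-(2 * π * (j + 1) * R))) (fun y hy => ?_)
    · simpa using this
    · rw [Set.uIoc_of_le (by linarith)] at hy
      have hy1 : 1 ≤ y := by linarith [hy.1]
      simp only [hg]
      rw [norm_mul, Complex.norm_exp]
      have hre : (Complex.I * (2 * π * (j + 1)) * (y + R * Complex.I)).re =
          -(2 * π * (j + 1) * R) := by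
        have : Complex.I * (2 * π * (j + 1)) * (y + R * Complex.I) =
            ((-(2 * π * (j + 1) * R) : ℝ) : ℂ) +
              ((2 * π * (j + 1) * y : ℝ) : ℂ) * Complex.I := by
          push_cast
          linear_combination (2 * π * (j + 1) * R : ℂ) * Complex.I_sq
        rw [this]; simp
      rw [hre]
      gcongr
      exact hC _ (half_le_re_add_mul_I hy1 R)
  have l1 := intervalIntegral_tendsto_integral_Ioi 0
    (integrableOn_im_logPowDiv_mul_exp m hk2 hc) tendsto_id
  have l2 := intervalIntegral_tendsto_integral_Ioi 0
    (integrableOn_im_logPowDiv_mul_exp m hk1 hc) tendsto_id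
  have hall := (htop.add l1).sub l2
  rw [zero_add] at hall
  exact tendsto_nhds_unique (tendsto_const_nhds.congr' ((eventually_ge_atTop 0).mono hrect)) hall

/-- The integral `∫₀^∞ Im F(a + i x) / (e^{2πx} - 1) dx` for `F z = log z ^ m / z`. -/
noncomputable def abelPlanaIntegral (m : ℕ) (a : ℝ) : ℝ :=
  ∫ x in Set.Ioi (0 : ℝ), (logPowDiv m 0 (a + x * Complex.I)).im *
    (1 / (Real.exp (2 * π * x) - 1))

theorem trapezoid_sub_integral (m k : ℕ) (hk : 1 ≤ k) :
    ((Real.log k ^ m / k + Real.log (k + 1) ^ m / (k + 1)) / 2 -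
      ∫ y in (k : ℝ)..(k + 1), Real.log y ^ m / y) / 2 =
      abelPlanaIntegral m ((k + 1 : ℕ) : ℝ) - abelPlanaIntegral m k := by
  have hk1 : (1 : ℝ) ≤ k := by exact_mod_cast hk
  have hk2 : (1 : ℝ) ≤ ((k + 1 : ℕ) : ℝ) := by exact_mod_cast Nat.le_succ_of_le hk
  obtain ⟨C, -, hC⟩ := exists_abs_im_logPowDiv_le m
  have s1 := (hasSum_integral_mul_exp_neg (continuous_im_logPowDiv m hk1)
    (fun x hx => hC k x hk1 hx)).1
  have s2 := (hasSum_integral_mul_exp_neg (continuous_im_logPowDiv m hk2)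
    (fun x hx => hC _ x hk2 hx)).1
  have hd : ∀ l, ∀ y ∈ Set.Icc (k : ℝ) (k + 1), HasDerivAt (fun y : ℝ => (logPowDiv m l y).re)
      (logPowDiv m (l + 1) y).re y := fun l y hy =>
    (hasDerivAt_logPowDiv m l (Complex.ofReal_mem_slitPlane.2
      (by linarith [hy.1]))).real_of_complex
  have s3 := hasSum_integral_mul_cos k (hd 0) (hd 1)
    (fun y hy => (hd 2 y hy).continuousAt.continuousWithinAt)
  have hre : ∀ y : ℝ, 0 ≤ y → (logPowDiv m 0 y).re = Real.log y ^ m / y := fun y hy => by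
    rw [logPowDiv_ofReal m hy, Complex.ofReal_re]
  have hI : ∀ w : ℝ → ℝ, (∫ y in (k : ℝ)..(k + 1), (logPowDiv m 0 y).re * w y) =
      ∫ y in (k : ℝ)..(k + 1), Real.log y ^ m / y * w y := fun w =>
    intervalIntegral.integral_congr fun y hy => by
      rw [Set.uIcc_of_le (by linarith)] at hy
      rw [hre y (by linarith [hy.1])]
  have hI1 := hI fun _ => 1
  simp only [mul_one] at hI1
  have hI2 := fun j : ℕ => hI fun y => Real.cos (2 * π * (j + 1) * y)
  rw [hI1, hre _ (by linarith), hre _ (by linarith)] at s3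
  simp only [hI2, integral_logPow_mul_cos m _ k hk] at s3
  exact s3.unique (s2.sub s1)

end LogPowAbelPlana

section StieltjesSeries

open MeasureTheory

theorem integral_logPow_div (m k : ℕ) (hk : 1 ≤ k) :
    (∫ y in (k : ℝ)..(k + 1), Real.log y ^ m / y) =
      Real.log (k + 1) ^ (m + 1) / (m + 1) - Real.log k ^ (m + 1) / (m + 1) := by
  have hk1 : (1 : ℝ) ≤ k := by exact_mod_cast hk
  have hy0 : ∀ y ∈ Set.uIcc (k : ℝ) (k + 1), y ≠ 0 := fun y hy => by
    rw [Set.uIcc_of_le (by linarith)] at hy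
    linarith [hy.1]
  refine intervalIntegral.integral_eq_sub_of_hasDerivAt
    (f := fun y => Real.log y ^ (m + 1) / (m + 1)) (fun y hy => ?_)
    (ContinuousOn.intervalIntegrable (((Real.continuousOn_log.mono
      (fun y hy => hy0 y hy)).pow m).div continuousOn_id hy0))
  refine (((Real.hasDerivAt_log (hy0 y hy)).fun_pow (m + 1)).div_const (m + 1 : ℝ)).congr_deriv ?_
  have := hy0 y hy
  push_cast
  field_simp

theorem stieltjesSeq_sub_eq (m N : ℕ) :
    stieltjesSeq m (N + 1) - (if m = 0 then (1 : ℝ) / 2 else 0) -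
        Real.log ((N + 1 : ℕ) : ℝ) ^ m / ((N + 1 : ℕ) : ℝ) / 2 =
      2 * (abelPlanaIntegral m ((N + 1 : ℕ) : ℝ) - abelPlanaIntegral m 1) := by
  induction N with
  | zero =>
    rcases eq_or_ne m 0 with rfl | hm
    · simp [stieltjesSeq]; norm_num
    · simp [stieltjesSeq, hm]
  | succ N ih =>
    have h := trapezoid_sub_integral m (N + 1) (by simp)
    rw [integral_logPow_div m (N + 1) (by simp)] at h
    have hs : stieltjesSeq m (N + 1 + 1) = stieltjesSeq m (N + 1) +
        Real.log (((N + 1 : ℕ) : ℝ) + 1) ^ m / (((N + 1 : ℕ) : ℝ) + 1) -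
        (Real.log (((N + 1 : ℕ) : ℝ) + 1) ^ (m + 1) / (m + 1) -
          Real.log ((N + 1 : ℕ) : ℝ) ^ (m + 1) / (m + 1)) := by
      rw [stieltjesSeq, stieltjesSeq, Finset.sum_range_succ _ (N + 1), Nat.cast_succ (N + 1)]
      ring
    rw [hs]
    have e : ((N + 1 + 1 : ℕ) : ℝ) = ((N + 1 : ℕ) : ℝ) + 1 := Nat.cast_succ (N + 1)
    rw [e] at h ⊢
    linarith

theorem tendsto_abelPlanaIntegral (m : ℕ) :
    Tendsto (fun N : ℕ => abelPlanaIntegral m ((N + 1 : ℕ) : ℝ)) atTop (𝓝 0) := by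
  obtain ⟨C, -, hC⟩ := exists_abs_im_logPowDiv_le m
  refine squeeze_zero_norm (a := fun N : ℕ => C / ((N + 1 : ℕ) : ℝ) / 24) (fun N => ?_) ?_
  · have h1 : (1 : ℝ) ≤ ((N + 1 : ℕ) : ℝ) := by exact_mod_cast Nat.le_add_left 1 N
    exact (hasSum_integral_mul_exp_neg (continuous_im_logPowDiv m h1)
      (fun x hx => hC _ x h1 hx)).2
  · simpa using ((tendsto_const_div_atTop_nhds_zero_nat C).comp
      (tendsto_add_atTop_nat 1)).div_const 24

theorem stieltjes_sub_eq_abelPlanaIntegral {m : ℕ} {γm : ℝ}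
    (hγ : Tendsto (stieltjesSeq m) atTop (𝓝 γm)) :
    γm - (if m = 0 then (1 : ℝ) / 2 else 0) = -2 * abelPlanaIntegral m 1 := by
  have hlog : Tendsto (fun N : ℕ => Real.log ((N + 1 : ℕ) : ℝ) ^ m / ((N + 1 : ℕ) : ℝ) / 2)
      atTop (𝓝 0) := by
    have h := ((Real.isLittleO_pow_log_id_atTop (n := m)).tendsto_div_nhds_zero.comp
      tendsto_natCast_atTop_atTop).comp (tendsto_add_atTop_nat 1)
    simpa [Function.comp_def] using h.div_const 2
  have hl := ((hγ.comp (tendsto_add_atTop_nat 1)).sub_const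
    (if m = 0 then (1 : ℝ) / 2 else 0)).sub hlog
  have hr := ((tendsto_abelPlanaIntegral m).sub_const (abelPlanaIntegral m 1)).const_mul 2
  have := tendsto_nhds_unique (hl.congr fun N => stieltjesSeq_sub_eq m N) hr
  linarith

theorem integral_pow_one_sub_exp_mul_exp (n : ℕ) :
    IntegrableOn (fun x : ℝ => (1 - Real.exp (-(2 * π * x))) ^ n * Real.exp (-(2 * π * x)))
      (Set.Ioi 0) ∧
    ∫ x in Set.Ioi (0 : ℝ), (1 - Real.exp (-(2 * π * x))) ^ n * Real.exp (-(2 * π * x)) =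
      1 / (2 * π * (n + 1)) := by
  have hF : ∀ x ∈ Set.Ici (0 : ℝ), HasDerivAt
      (fun x => (1 - Real.exp (-(2 * π * x))) ^ (n + 1) / (2 * π * (n + 1)))
      ((1 - Real.exp (-(2 * π * x))) ^ n * Real.exp (-(2 * π * x))) x := by
    intro x _
    have hl : HasDerivAt (fun x => -(2 * π * x)) (-(2 * π)) x := by
      simpa using ((hasDerivAt_id x).const_mul (2 * π)).fun_neg
    refine (((hl.exp.const_sub 1).fun_pow (n + 1)).div_const (2 * π * (n + 1))).congr_deriv ?_
    push_cast
    field_simp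
  have hpos : ∀ x ∈ Set.Ioi (0 : ℝ),
      0 ≤ (1 - Real.exp (-(2 * π * x))) ^ n * Real.exp (-(2 * π * x)) := fun x hx => by
    have hx' : 0 < x := hx
    have : Real.exp (-(2 * π * x)) ≤ 1 := Real.exp_le_one_iff.2 (by
      have : 0 ≤ 2 * π * x := by positivity
      linarith)
    have : 0 ≤ 1 - Real.exp (-(2 * π * x)) := by linarith
    positivity
  have hlim : Tendsto (fun x => (1 - Real.exp (-(2 * π * x))) ^ (n + 1) / (2 * π * (n + 1)))
      atTop (𝓝 (1 / (2 * π * (n + 1)))) := by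
    have h := Real.tendsto_exp_neg_atTop_nhds_zero.comp
      (tendsto_id.const_mul_atTop (by positivity : 0 < 2 * π))
    simpa using ((h.const_sub 1).pow (n + 1)).div_const (2 * π * (n + 1))
  refine ⟨integrableOn_Ioi_deriv_of_nonneg' hF hpos hlim, ?_⟩
  rw [integral_Ioi_of_hasDerivAt_of_nonneg' hF hpos hlim]
  simp

theorem hasSum_im_shiftCoeff_mul (m : ℕ) {x : ℝ} (hx : 0 < x) :
    HasSum (fun n : ℕ => (shiftCoeff m (n + 1)).im *
        ((1 - Real.exp (-(2 * π * x))) ^ n * Real.exp (-(2 * π * x))))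
      ((logPowDiv m 0 ((1 : ℝ) + x * Complex.I)).im * (1 / (Real.exp (2 * π * x) - 1))) := by
  set t : ℝ := 1 - Real.exp (-(2 * π * x)) with ht
  have hx2 : 0 < 2 * π * x := by positivity
  have hlt : Real.exp (-(2 * π * x)) < 1 := Real.exp_lt_one_iff.2 (by linarith)
  have ht0 : 0 < t := by linarith
  have hu : (t : ℂ) ∈ Metric.ball (0 : ℂ) 1 := by
    rw [mem_ball_zero_iff, Complex.norm_real, Real.norm_eq_abs, abs_of_pos ht0, ht]
    linarith [Real.exp_pos (-(2 * π * x))]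
  have h := Complex.hasSum_im (hasSum_shiftCoeff m hu)
  rw [logShift_ofReal x, ← hasSum_nat_add_iff' 1] at h
  have h0 : (shiftCoeff m 0).im = 0 := by
    rw [shiftCoeff_im]; simp [S1_eq_zero_of_lt]
  simp only [Finset.sum_range_one, pow_zero, mul_one, h0, sub_zero] at h
  have he : 1 / (Real.exp (2 * π * x) - 1) = Real.exp (-(2 * π * x)) / t := by
    rw [ht, Real.exp_neg] at *
    have : Real.exp (2 * π * x) - 1 ≠ 0 := by linarith [Real.add_one_lt_exp hx2.ne']
    field_simp
  rw [he]
  refine (h.mul_right (Real.exp (-(2 * π * x)) / t)).congr_fun fun n => ?_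
  rw [← Complex.ofReal_pow, Complex.im_mul_ofReal, pow_succ]
  field_simp

theorem hasSum_abelPlanaIntegral_one (m : ℕ) :
    HasSum (fun n : ℕ => (shiftCoeff m (n + 1)).im / (2 * π * (n + 1)))
      (abelPlanaIntegral m 1) := by
  have hinteg : ∀ n : ℕ, IntegrableOn (fun x : ℝ => (shiftCoeff m (n + 1)).im *
      ((1 - Real.exp (-(2 * π * x))) ^ n * Real.exp (-(2 * π * x)))) (Set.Ioi 0) := fun n =>
    (integral_pow_one_sub_exp_mul_exp n).1.const_mul _
  have hnorm : ∀ n : ℕ, ∫ x in Set.Ioi (0 : ℝ), ‖(shiftCoeff m (n + 1)).im *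
      ((1 - Real.exp (-(2 * π * x))) ^ n * Real.exp (-(2 * π * x)))‖ =
      |(shiftCoeff m (n + 1)).im| * (1 / (2 * π * (n + 1))) := by
    intro n
    rw [← (integral_pow_one_sub_exp_mul_exp n).2, ← integral_const_mul]
    refine setIntegral_congr_fun measurableSet_Ioi fun x hx => ?_
    have hx' : 0 < x := hx
    have hx2 : 0 < 2 * π * x := by positivity
    have : 0 ≤ 1 - Real.exp (-(2 * π * x)) := by
      linarith [Real.exp_lt_one_iff.2 (by linarith : -(2 * π * x) < 0)]
    simp only [norm_mul, Real.norm_eq_abs]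
    rw [abs_of_nonneg (pow_nonneg this n), Real.abs_exp]
  have hsumm : Summable fun n : ℕ => ∫ x in Set.Ioi (0 : ℝ), ‖(shiftCoeff m (n + 1)).im *
      ((1 - Real.exp (-(2 * π * x))) ^ n * Real.exp (-(2 * π * x)))‖ := by
    simp_rw [hnorm]
    refine Summable.of_nonneg_of_le (fun n => by positivity) (fun n => ?_)
      ((summable_norm_shiftCoeff_div m).mul_left (1 / (2 * π)))
    calc |(shiftCoeff m (n + 1)).im| * (1 / (2 * π * (n + 1)))
        ≤ ‖shiftCoeff m (n + 1)‖ * (1 / (2 * π * (n + 1))) := by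
          gcongr
          exact Complex.abs_im_le_norm _
      _ = 1 / (2 * π) * (‖shiftCoeff m (n + 1)‖ / (n + 1)) := by
          field_simp
  have h := hasSum_integral_of_summable_integral_norm hinteg hsumm
  have heq : (∫ x in Set.Ioi (0 : ℝ), ∑' n : ℕ, (shiftCoeff m (n + 1)).im *
      ((1 - Real.exp (-(2 * π * x))) ^ n * Real.exp (-(2 * π * x)))) = abelPlanaIntegral m 1 :=
    setIntegral_congr_fun measurableSet_Ioi fun x hx => (hasSum_im_shiftCoeff_mul m hx).tsum_eq
  rw [heq] at h
  refine h.congr_fun fun n => ?_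
  rw [integral_const_mul, (integral_pow_one_sub_exp_mul_exp n).2]
  ring

end StieltjesSeries

/-- For every `m ≥ 0`, the Stieltjes constant `γ_m` equals
`(1/2)δ_{m,0} + ((−1)^m m!/π) Σ_{n≥1} (1/(n·n!)) Σ_{k=0}^{⌊n/2⌋}
(−1)^k |S₁(2k+2,m+1)| |S₁(n,2k+1)| / (2π)^{2k+1}`, the outer series being convergent. -/
theorem stieltjes_series_pi (m : ℕ) (γm : ℝ)
    (hγ : Tendsto (stieltjesSeq m) atTop (nhds γm)) :
    HasSum (fun n : ℕ =>
      ((-1 : ℝ) ^ m * (Nat.factorial m) / Real.pi) *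
        ((1 : ℝ) / ((n + 1) * Nat.factorial (n + 1)) *
          ∑ k ∈ Finset.range ((n + 1) / 2 + 1),
            (-1 : ℝ) ^ k * (S1 (2 * k + 2) (m + 1)) * (S1 (n + 1) (2 * k + 1)) /
              (2 * Real.pi) ^ (2 * k + 1)))
      (γm - (if m = 0 then (1 : ℝ) / 2 else 0)) := by
  rw [stieltjes_sub_eq_abelPlanaIntegral hγ]
  refine ((hasSum_abelPlanaIntegral_one m).mul_left (-2)).congr_fun fun n => ?_
  rw [shiftCoeff_im]
  field_simp
end

section
/- Euler's constant γ admits the convergent series representation γ = 1/2 + (1/π) · Σ_{n=1}^{∞} (1/(n·n!)) · Σ_{k=0}^{⌊n/2⌋} (−1)^k · (2k+1)! · |S₁(n, 2k+1)| / (2π)^{2k+1}. -/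
open Finset Filter Real

/-- The binomial series of `(1 - t)^(-z)`. -/
theorem hasSum_ascPochhammer_mul_pow (z t : ℂ) (ht : ‖t‖ < 1) :
    HasSum (fun n : ℕ => (ascPochhammer ℂ n).eval z / n.factorial * t ^ n)
      (1 / (1 - t) ^ z) := by
  have h := (Complex.one_div_one_sub_cpow_hasFPowerSeriesOnBall_zero z).hasSum (y := t)
    (by simpa using (enorm_lt_coe (r := 1)).2 (by exact_mod_cast ht))
  rw [zero_add] at h
  convert! h using 2 with n
  have h2 : (n.factorial : ℂ) * Ring.choose (z + n - 1) n = (ascPochhammer ℂ n).eval z := by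
    rw [← Ring.multichoose_eq, ← nsmul_eq_mul, Ring.factorial_nsmul_multichoose_eq_ascPochhammer,
      Polynomial.ascPochhammer_smeval_eq_eval]
  rw [← h2, FormalMultilinearSeries.ofScalars_apply_eq]
  have := Nat.cast_ne_zero (R := ℂ) |>.mpr n.factorial_ne_zero
  field_simp
  simp [mul_comm]

/-- Euler's sine product bounds `∏ (1 + x²/j²)` by `sinh (πx) / (πx) ≤ exp (πx)`. -/
theorem prod_one_add_sq_div_sq_le {x : ℝ} (hx : 0 < x) (n : ℕ) :
    ∏ j ∈ range n, (1 + x ^ 2 / ((j : ℝ) + 1) ^ 2) ≤ exp (π * x) := by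
  have h := Complex.tendsto_euler_sin_prod (x * Complex.I)
  have h1 : Tendsto (fun n : ℕ => π * x * ∏ j ∈ range n, (1 + x ^ 2 / ((j : ℝ) + 1) ^ 2)) atTop
      (nhds (sinh (π * x))) := by
    have h2 := (Complex.continuous_im.tendsto _).comp h
    convert h2 using 1
    · funext n
      have : (π : ℂ) * (x * Complex.I) * ∏ j ∈ range n,
          ((1 : ℂ) - (x * Complex.I) ^ 2 / ((j : ℂ) + 1) ^ 2)
          = ((π * x * ∏ j ∈ range n, (1 + x ^ 2 / ((j : ℝ) + 1) ^ 2) : ℝ) : ℂ) * Complex.I := by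
        push_cast
        simp only [mul_pow, Complex.I_sq, mul_neg_one, neg_div, sub_neg_eq_add]
        ring
      simp only [Function.comp, this, Complex.im_ofReal_mul, Complex.I_im,
        mul_one]
    · rw [← mul_assoc, Complex.sin_mul_I, ← Complex.ofReal_mul, ← Complex.ofReal_sinh,
        Complex.im_ofReal_mul, Complex.I_im, mul_one]
  have hmono : Monotone (fun n : ℕ => π * x * ∏ j ∈ range n, (1 + x ^ 2 / ((j : ℝ) + 1) ^ 2)) := by
    refine monotone_nat_of_le_succ fun n => ?_
    rw [prod_range_succ]
    have h0 : 0 ≤ ∏ j ∈ range n, (1 + x ^ 2 / ((j : ℝ) + 1) ^ 2) :=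
      prod_nonneg fun _ _ => by positivity
    gcongr
    exact le_mul_of_one_le_right h0 (by simp; positivity)
  have h3 := hmono.ge_of_tendsto h1 n
  have h4 : sinh (π * x) ≤ π * x * exp (π * x) := by
    have hy : 0 < π * x := by positivity
    set y := π * x
    rw [sinh_eq, exp_neg]
    have h5 : 1 - 2 * y ≤ (exp y)⁻¹ ^ 2 := by
      rw [← exp_neg, ← exp_nat_mul]
      have := add_one_le_exp (((2 : ℕ) : ℝ) * (-y))
      push_cast at this ⊢
      linarith
    have h6 := exp_pos y
    have h7 : exp y * (exp y)⁻¹ ^ 2 = (exp y)⁻¹ := by field_simp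
    nlinarith
  exact le_of_mul_le_mul_left (h3.trans h4) (by positivity)

theorem norm_ascPochhammer_eval_mul_I_sq (x : ℝ) (n : ℕ) :
    ‖(ascPochhammer ℂ (n + 1)).eval (x * Complex.I)‖ ^ 2 =
      (n.factorial * x) ^ 2 * ∏ j ∈ range n, (1 + x ^ 2 / ((j : ℝ) + 1) ^ 2) := by
  induction n with
  | zero => simp
  | succ n ih =>
    rw [ascPochhammer_succ_eval, norm_mul, mul_pow, ih, prod_range_succ, Complex.sq_norm,
      Nat.factorial_succ]
    have : Complex.normSq (x * Complex.I + ((n + 1 : ℕ) : ℂ)) = x ^ 2 + (n + 1) ^ 2 := by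
      simp [Complex.normSq_apply]; ring
    rw [this]
    have : (n : ℝ) + 1 ≠ 0 := by positivity
    push_cast
    field_simp
    ring

theorem norm_ascPochhammer_eval_mul_I_le {x : ℝ} (hx : 0 < x) (n : ℕ) :
    ‖(ascPochhammer ℂ (n + 1)).eval (x * Complex.I)‖ ≤ n.factorial * (x * exp (π * x)) := by
  refine le_of_sq_le_sq ?_ (by positivity)
  rw [norm_ascPochhammer_eval_mul_I_sq]
  have h := prod_one_add_sq_div_sq_le hx n
  have h1 : 1 ≤ exp (π * x) := one_le_exp (by positivity)
  calc _ ≤ (n.factorial * x) ^ 2 * exp (π * x) := by gcongr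
    _ ≤ (n.factorial * x) ^ 2 * (exp (π * x)) ^ 2 := by gcongr; nlinarith
    _ = _ := by ring

theorem im_ascPochhammer_eval_mul_I (x : ℝ) (n : ℕ) :
    ((ascPochhammer ℂ n).eval (x * Complex.I)).im =
      ∑ k ∈ range (n / 2 + 1), (-1) ^ k * (S1 n (2 * k + 1) : ℝ) * x ^ (2 * k + 1) := by
  have h1 : (ascPochhammer ℂ n).eval (x * Complex.I) =
      ∑ l ∈ range (2 * (n / 2 + 1)), (S1 n l : ℂ) * (x * Complex.I) ^ l := by
    rw [Polynomial.eval_eq_sum_range' (n := 2 * (n / 2 + 1))]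
    · refine sum_congr rfl fun l _ => ?_
      rw [S1, ← ascPochhammer_map (Nat.castRingHom ℂ), Polynomial.coeff_map]
      simp
    · rw [ascPochhammer_natDegree]; omega
  have h2 : ∀ (a : ℕ → ℕ) (K : ℕ), (∑ l ∈ range (2 * K), (a l : ℂ) * (x * Complex.I) ^ l).im =
      ∑ k ∈ range K, (-1) ^ k * (a (2 * k + 1) : ℝ) * x ^ (2 * k + 1) := by
    intro a K
    induction K with
    | zero => simp
    | succ K ih =>
      rw [show 2 * (K + 1) = 2 * K + 1 + 1 by ring, sum_range_succ, sum_range_succ,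
        sum_range_succ, Complex.add_im, Complex.add_im, ih]
      have e1 : (a (2 * K) : ℂ) * (x * Complex.I) ^ (2 * K) =
          ((a (2 * K) * (-1) ^ K * x ^ (2 * K) : ℝ) : ℂ) := by
        rw [mul_pow, pow_mul Complex.I, Complex.I_sq]; push_cast; ring
      have e2 : (a (2 * K + 1) : ℂ) * (x * Complex.I) ^ (2 * K + 1) =
          (((-1) ^ K * a (2 * K + 1) * x ^ (2 * K + 1) : ℝ) : ℂ) * Complex.I := by
        rw [mul_pow, pow_succ Complex.I, pow_mul Complex.I, Complex.I_sq]; push_cast; ring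
      rw [e1, e2]
      simp only [Complex.ofReal_im, Complex.im_ofReal_mul, Complex.I_im, mul_one, add_zero]
  rw [h1, h2]

theorem integrableOn_one_sub_exp_neg_pow_mul (n : ℕ) :
    MeasureTheory.IntegrableOn (fun s : ℝ => (1 - exp (-s)) ^ n * exp (-s)) (Set.Ioi 0) ∧
      ∫ s in Set.Ioi (0 : ℝ), (1 - exp (-s)) ^ n * exp (-s) = 1 / ((n : ℝ) + 1) := by
  have hn : (n : ℝ) + 1 ≠ 0 := by positivity
  have hd : ∀ s ∈ Set.Ici (0 : ℝ), HasDerivAt (fun s : ℝ => (1 - exp (-s)) ^ (n + 1) / ((n : ℝ) + 1))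
      ((1 - exp (-s)) ^ n * exp (-s)) s := by
    intro s _
    have := ((((hasDerivAt_neg s).exp).const_sub 1).pow (n + 1)).div_const ((n : ℝ) + 1)
    convert! this using 1
    push_cast
    field_simp
  have hnn : ∀ s ∈ Set.Ioi (0 : ℝ), 0 ≤ (1 - exp (-s)) ^ n * exp (-s) := by
    intro s hs
    have : exp (-s) ≤ 1 := exp_le_one_iff.2 (by simpa using hs.le)
    have : 0 ≤ 1 - exp (-s) := by linarith
    positivity
  have hl : Tendsto (fun s : ℝ => (1 - exp (-s)) ^ (n + 1) / ((n : ℝ) + 1)) atTop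
      (nhds (1 / ((n : ℝ) + 1))) := by
    have := ((tendsto_exp_neg_atTop_nhds_zero.const_sub 1).pow (n + 1)).div_const ((n : ℝ) + 1)
    simpa using this
  exact ⟨MeasureTheory.integrableOn_Ioi_deriv_of_nonneg' hd hnn hl,
    by simpa using MeasureTheory.integral_Ioi_of_hasDerivAt_of_nonneg' hd hnn hl⟩

theorem hasSum_im_ascPochhammer_mul_one_sub_exp_neg_pow (x : ℝ) {s : ℝ} (hs : 0 < s) :
    HasSum (fun n : ℕ => ((ascPochhammer ℂ (n + 1)).eval (x * Complex.I)).im / (n + 1).factorial *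
      ((1 - exp (-s)) ^ n * exp (-s))) (sin (x * s) * (exp (-s) / (1 - exp (-s)))) := by
  have h0 := exp_pos (-s)
  have h1 : exp (-s) < 1 := exp_lt_one_iff.2 (by linarith)
  have h2 : 0 < 1 - exp (-s) := by linarith
  have h := hasSum_ascPochhammer_mul_pow (x * Complex.I) ((1 - exp (-s) : ℝ) : ℂ)
    (by rw [Complex.norm_real, norm_of_nonneg h2.le]; linarith)
  have e : 1 / (1 - ((1 - exp (-s) : ℝ) : ℂ)) ^ (x * Complex.I) =
      Complex.exp ((x * s : ℝ) * Complex.I) := by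
    rw [show (1 : ℂ) - ((1 - exp (-s) : ℝ) : ℂ) = ((exp (-s) : ℝ) : ℂ) by push_cast; ring,
      Complex.cpow_def_of_ne_zero (by exact_mod_cast h0.ne'), ← Complex.ofReal_log h0.le, log_exp,
      one_div, ← Complex.exp_neg]
    push_cast
    ring_nf
  rw [e] at h
  have him := Complex.hasSum_im h
  rw [Complex.exp_ofReal_mul_I_im] at him
  have him' := ((hasSum_nat_add_iff' 1).2 him).mul_right (exp (-s) / (1 - exp (-s)))
  simp only [sum_range_one, ascPochhammer_zero, Polynomial.eval_one, Nat.factorial_zero,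
    Nat.cast_one, div_one, pow_zero, mul_one, Complex.one_im, sub_zero] at him'
  refine him'.congr_fun ?_
  intro n
  rw [← Complex.ofReal_pow, Complex.im_mul_ofReal, Complex.div_natCast_im, pow_succ]
  field_simp

theorem hasSum_im_ascPochhammer_div (x : ℝ) (hx : 0 < x) :
    HasSum (fun n : ℕ => ((ascPochhammer ℂ (n + 1)).eval (x * Complex.I)).im /
      (((n : ℝ) + 1) * (n + 1).factorial))
      (∫ s in Set.Ioi (0 : ℝ), sin (x * s) * (exp (-s) / (1 - exp (-s)))) := by
  have h := MeasureTheory.hasSum_integral_of_summable_integral_norm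
    (μ := MeasureTheory.volume.restrict (Set.Ioi (0 : ℝ)))
    (F := fun (n : ℕ) s => ((ascPochhammer ℂ (n + 1)).eval (x * Complex.I)).im /
      (n + 1).factorial * ((1 - exp (-s)) ^ n * exp (-s)))
    (fun n => (integrableOn_one_sub_exp_neg_pow_mul n).1.const_mul _) ?_
  · convert! h using 1
    · funext n
      rw [MeasureTheory.integral_const_mul, (integrableOn_one_sub_exp_neg_pow_mul n).2]
      field_simp
    · refine MeasureTheory.setIntegral_congr_fun measurableSet_Ioi fun s hs => ?_
      exact (hasSum_im_ascPochhammer_mul_one_sub_exp_neg_pow x hs).tsum_eq.symm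
  · refine Summable.of_nonneg_of_le
      (fun n => MeasureTheory.integral_nonneg fun s => norm_nonneg _) (fun n => ?_)
      (((summable_nat_add_iff 1).2 (summable_one_div_nat_pow.2 one_lt_two)).mul_left
        (x * exp (π * x)))
    have e : ∫ s in Set.Ioi (0 : ℝ), ‖((ascPochhammer ℂ (n + 1)).eval (x * Complex.I)).im /
        (n + 1).factorial * ((1 - exp (-s)) ^ n * exp (-s))‖ =
        ∫ s in Set.Ioi (0 : ℝ), |((ascPochhammer ℂ (n + 1)).eval (x * Complex.I)).im| /
        (n + 1).factorial * ((1 - exp (-s)) ^ n * exp (-s)) := by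
      refine MeasureTheory.setIntegral_congr_fun measurableSet_Ioi fun s hs => ?_
      have h1 : exp (-s) < 1 := exp_lt_one_iff.2 (by simpa using hs)
      have h2 : 0 < 1 - exp (-s) := by linarith
      simp only [norm_mul, norm_div, norm_eq_abs, abs_pow, abs_of_pos h2, abs_exp, Nat.abs_cast]
    rw [e, MeasureTheory.integral_const_mul, (integrableOn_one_sub_exp_neg_pow_mul n).2]
    have hb := (Complex.abs_im_le_norm _).trans (norm_ascPochhammer_eval_mul_I_le hx n)
    rw [Nat.factorial_succ]
    push_cast
    have hf : (0 : ℝ) < n.factorial := by exact_mod_cast n.factorial_pos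
    calc _ ≤ n.factorial * (x * exp (π * x)) / (((n : ℝ) + 1) * n.factorial) * (1 / ((n : ℝ) + 1)) := by
            gcongr
      _ = _ := by field_simp

theorem hasSum_div_sq_add_sq (x : ℝ) (hx : 0 < x) :
    HasSum (fun n : ℕ => x / (((n : ℝ) + 1) ^ 2 + x ^ 2))
      (∫ s in Set.Ioi (0 : ℝ), sin (x * s) * (exp (-s) / (1 - exp (-s)))) := by
  have hre : ∀ n : ℕ, ((-((n : ℝ) + 1) : ℝ) + x * Complex.I : ℂ).re < 0 := by
    intro n
    have : 0 < (n : ℝ) + 1 := by positivity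
    simp
    linarith
  have him : ∀ (n : ℕ) (s : ℝ), (Complex.exp (((-((n : ℝ) + 1) : ℝ) + x * Complex.I) * s)).im =
      sin (x * s) * exp (-((n : ℝ) + 1) * s) := by
    intro n s
    rw [Complex.exp_im]
    simp [mul_comm]
  have hI : ∀ n : ℕ, MeasureTheory.Integrable (fun s : ℝ => sin (x * s) * exp (-((n : ℝ) + 1) * s))
      (MeasureTheory.volume.restrict (Set.Ioi (0 : ℝ))) := by
    intro n
    have := (integrableOn_exp_mul_complex_Ioi (hre n) 0).im
    simpa only [RCLike.im_to_complex, him] using this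
  have hG : ∀ n : ℕ, MeasureTheory.IntegrableOn (fun s : ℝ => s * exp (-((n : ℝ) + 1) * s))
      (Set.Ioi (0 : ℝ)) ∧ ∫ s in Set.Ioi (0 : ℝ), s * exp (-((n : ℝ) + 1) * s) =
        1 / ((n : ℝ) + 1) ^ 2 := by
    intro n
    have hn : 0 < (n : ℝ) + 1 := by positivity
    have h1 := integral_rpow_mul_exp_neg_mul_Ioi (a := 2) two_pos hn
    have h2 := integrableOn_rpow_mul_exp_neg_mul_rpow (s := 1) (p := 1) (by norm_num) one_pos hn
    norm_num at h1
    simp only [rpow_one] at h2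
    have h3 : ∀ s : ℝ, -((n : ℝ) + 1) * s = -(((n : ℝ) + 1) * s) := fun s => by ring
    simp only [h3]
    refine ⟨by simpa only [neg_mul] using h2, ?_⟩
    simpa using h1
  have h := MeasureTheory.hasSum_integral_of_summable_integral_norm
    (μ := MeasureTheory.volume.restrict (Set.Ioi (0 : ℝ))) hI ?_
  · convert! h using 1
    · funext n
      have h1 := integral_exp_mul_complex_Ioi (hre n) 0
      have h2 := integral_im (integrableOn_exp_mul_complex_Ioi (hre n) 0)
      simp only [RCLike.im_to_complex, him, h1] at h2
      rw [h2]
      simp [Complex.div_im, Complex.normSq_apply]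
      ring_nf
    · refine MeasureTheory.setIntegral_congr_fun measurableSet_Ioi fun s hs => ?_
      have h1 : exp (-s) < 1 := exp_lt_one_iff.2 (by simpa using hs)
      have h2 := ((hasSum_geometric_of_lt_one (exp_pos _).le h1).mul_left
        (sin (x * s) * exp (-s))).tsum_eq
      rw [mul_div_assoc', div_eq_mul_inv, ← h2]
      refine tsum_congr fun n => ?_
      rw [mul_assoc, ← exp_nat_mul, ← exp_add]
      ring_nf
  · refine Summable.of_nonneg_of_le
      (fun n => MeasureTheory.integral_nonneg fun s => norm_nonneg _) (fun n => ?_)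
      (((summable_nat_add_iff 1).2 (summable_one_div_nat_pow.2 one_lt_two)).mul_left x)
    push_cast
    rw [← (hG n).2, ← MeasureTheory.integral_const_mul]
    refine MeasureTheory.setIntegral_mono_on (hI n).norm ((hG n).1.const_mul _)
      measurableSet_Ioi fun s hs => ?_
    have hs' : 0 < s := hs
    rw [norm_mul, norm_eq_abs, norm_eq_abs, abs_exp, ← mul_assoc]
    gcongr
    exact (abs_sin_le_abs).trans (abs_of_pos (by positivity)).le

/-- `∫₀^∞ sin (xs) / (exp s - 1) ds` in closed form, via the Mittag-Leffler expansion of the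
cotangent. -/
theorem integral_sin_mul_eq (x : ℝ) (hx : 0 < x) :
    2 * ∫ s in Set.Ioi (0 : ℝ), sin (x * s) * (exp (-s) / (1 - exp (-s))) =
      π * (1 + 2 * (exp (-(2 * π * x)) / (1 - exp (-(2 * π * x))))) - 1 / x := by
  rw [← (hasSum_div_sq_add_sq x hx).tsum_eq]
  have hz : (x * Complex.I : ℂ) ∈ Complex.integerComplement := by
    rintro ⟨n, hn⟩
    have := congrArg Complex.im hn
    simp at this
    exact hx.ne this
  have h := cot_series_rep' hz
  have e : ∀ n : ℕ, (1 / ((x : ℂ) * Complex.I - (n + 1)) + 1 / (x * Complex.I + (n + 1))) =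
      (-2 * Complex.I) * ((x / (((n : ℝ) + 1) ^ 2 + x ^ 2) : ℝ) : ℂ) := by
    intro n
    have h1 : ((x : ℂ) * Complex.I - (n + 1)) * (x * Complex.I + (n + 1)) =
        -((((n : ℝ) + 1) ^ 2 + x ^ 2 : ℝ) : ℂ) := by
      push_cast
      linear_combination (x : ℂ) ^ 2 * Complex.I_sq
    have h0 : ((((n : ℝ) + 1) ^ 2 + x ^ 2 : ℝ) : ℂ) ≠ 0 := by
      exact_mod_cast (by positivity : ((n : ℝ) + 1) ^ 2 + x ^ 2 ≠ 0)
    have h2 := h1 ▸ neg_ne_zero.2 h0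
    rw [one_div_add_one_div (left_ne_zero_of_mul h2) (right_ne_zero_of_mul h2), h1,
      Complex.ofReal_div]
    field_simp
    ring
  simp only [e] at h
  rw [tsum_mul_left, ← Complex.ofReal_tsum, Complex.cot_pi_eq_exp_ratio,
    show 2 * (π : ℂ) * Complex.I * (x * Complex.I) = ((-(2 * π * x) : ℝ) : ℂ) by
      push_cast; linear_combination 2 * (π : ℂ) * x * Complex.I_sq, ← Complex.ofReal_exp] at h
  set E := exp (-(2 * π * x))
  have hE : E < 1 := exp_lt_one_iff.2 (by simpa using by positivity)
  have hE1 : 1 - E ≠ 0 := by linarith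
  have hE' : (1 : ℂ) - E ≠ 0 := by exact_mod_cast hE1
  have hx' : (x : ℂ) ≠ 0 := by exact_mod_cast hx.ne'
  set S := ∑' n : ℕ, x / (((n : ℝ) + 1) ^ 2 + x ^ 2)
  have key : ((2 * S : ℝ) : ℂ) = ((π * (1 + 2 * (E / (1 - E))) - 1 / x : ℝ) : ℂ) := by
    have h3 : ((2 * S : ℝ) : ℂ) = Complex.I * (-2 * Complex.I * S) := by
      push_cast
      linear_combination (2 * S : ℂ) * Complex.I_sq
    rw [h3, ← h]
    push_cast
    have := Complex.I_ne_zero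
    field_simp
    ring
  exact_mod_cast key

theorem hasSum_inv_sub_log_eulerMascheroniConstant :
    HasSum (fun n : ℕ => 1 / ((n : ℝ) + 1) - log (((n : ℝ) + 2) / ((n : ℝ) + 1)))
      eulerMascheroniConstant := by
  rw [hasSum_iff_tendsto_nat_of_nonneg]
  · convert! tendsto_harmonic_sub_log_add_one using 1
    funext n
    induction n with
    | zero => simp
    | succ n ih =>
      rw [sum_range_succ, ih, harmonic_succ, log_div (by positivity) (by positivity)]
      push_cast
      rw [one_div, add_assoc, one_add_one_eq_two]
      ring
  · intro n
    have hn : 0 < (n : ℝ) + 1 := by positivity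
    have h := log_le_sub_one_of_pos (x := ((n : ℝ) + 2) / ((n : ℝ) + 1)) (by positivity)
    have : ((n : ℝ) + 2) / ((n : ℝ) + 1) - 1 = 1 / ((n : ℝ) + 1) := by field_simp; ring
    linarith

/-- `γ = ∫₀^∞ exp (-u) (1 / (1 - exp (-u)) - 1 / u) du`. -/
theorem integral_eulerMascheroni_kernel :
    MeasureTheory.IntegrableOn (fun u : ℝ => exp (-u) * (1 / (1 - exp (-u)) - 1 / u)) (Set.Ioi 0) ∧
      ∫ u in Set.Ioi (0 : ℝ), exp (-u) * (1 / (1 - exp (-u)) - 1 / u) =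
        eulerMascheroniConstant := by
  have hlt : ∀ u ∈ Set.Ioi (0 : ℝ), 0 < 1 - exp (-u) ∧ 1 - exp (-u) ≤ u := by
    intro u hu
    have h1 : exp (-u) < 1 := exp_lt_one_iff.2 (by simpa using hu)
    have h2 := add_one_le_exp (-u)
    constructor <;> linarith
  have hexp : ∀ n : ℕ, MeasureTheory.IntegrableOn (fun u : ℝ => exp (-((n : ℝ) + 1) * u))
      (Set.Ioi 0) := fun n => integrableOn_exp_mul_Ioi (by simp; linarith [n.cast_nonneg (α := ℝ)]) 0
  constructor
  · refine MeasureTheory.Integrable.mono' (hexp 0) (by fun_prop) ?_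
    filter_upwards [MeasureTheory.ae_restrict_mem measurableSet_Ioi] with u hu
    have hu' : 0 < u := hu
    obtain ⟨h1, h2⟩ := hlt u hu
    have h3 : 0 ≤ 1 / (1 - exp (-u)) - 1 / u := sub_nonneg.2 (one_div_le_one_div_of_le h1 h2)
    have h4 : 1 / (1 - exp (-u)) - 1 / u ≤ 1 := by
      have h5 : (u + 1) * exp (-u) ≤ 1 := by
        have := mul_le_mul_of_nonneg_right (add_one_le_exp u) (exp_pos (-u)).le
        rwa [← exp_add, add_neg_cancel, exp_zero] at this
      rw [div_sub_div _ _ h1.ne' hu'.ne', div_le_one (by positivity)]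
      linarith
    rw [norm_mul, norm_of_nonneg (exp_pos _).le, norm_of_nonneg h3]
    simpa using mul_le_mul_of_nonneg_left h4 (exp_pos (-u)).le
  · set J : ℕ → ℝ → ℝ := fun n u => exp (-((n : ℝ) + 1) * u) * (1 - (1 - exp (-u)) / u) with hJ
    have hF : ∀ (n : ℕ) (u : ℝ), exp (-((n : ℝ) + 1) * u) * ((1 - exp (-u)) / u) =
        u⁻¹ • (exp (-(((n : ℝ) + 1) * u)) - exp (-(((n : ℝ) + 2) * u))) := by
      intro n u
      rw [show -(((n : ℝ) + 2) * u) = -((n : ℝ) + 1) * u + -u by ring, exp_add, smul_eq_mul]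
      ring_nf
    have hJ2 : ∀ n : ℕ, MeasureTheory.IntegrableOn
        (fun u => exp (-((n : ℝ) + 1) * u) * ((1 - exp (-u)) / u)) (Set.Ioi 0) := by
      intro n
      refine MeasureTheory.Integrable.mono' (hexp n) (by fun_prop) ?_
      filter_upwards [MeasureTheory.ae_restrict_mem measurableSet_Ioi] with u hu
      obtain ⟨h1, h2⟩ := hlt u hu
      have hu' : 0 < u := hu
      rw [norm_mul, norm_of_nonneg (exp_pos _).le, norm_of_nonneg (by positivity)]
      exact mul_le_of_le_one_right (exp_pos _).le ((div_le_one hu').2 h2)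
    have hJint : ∀ n, MeasureTheory.IntegrableOn (J n) (Set.Ioi 0) := by
      intro n
      simpa only [hJ, mul_sub, mul_one] using! (hexp n).sub (hJ2 n)
    have hJval : ∀ n, ∫ u in Set.Ioi (0 : ℝ), J n u =
        1 / ((n : ℝ) + 1) - log (((n : ℝ) + 2) / ((n : ℝ) + 1)) := by
      intro n
      have hfr := Frullani.integral_Ioi_eq (f := fun u : ℝ => exp (-u)) (L := 1) (R := 0)
        (a := (n : ℝ) + 1) (b := (n : ℝ) + 2)
        ((by fun_prop : Continuous fun u : ℝ => exp (-u)).locallyIntegrable.locallyIntegrableOn _)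
        (by positivity) (by positivity)
        (by
          have : Tendsto (fun u : ℝ => exp (-u)) (nhds 0) (nhds (exp (-0))) :=
            (by fun_prop : Continuous fun u : ℝ => exp (-u)).tendsto 0
          simp only [neg_zero, exp_zero] at this
          exact this.mono_left nhdsWithin_le_nhds)
        tendsto_exp_neg_atTop_nhds_zero (by simpa only [hF] using hJ2 n)
      simp only [← hF] at hfr
      simp only [hJ, mul_sub, mul_one]
      rw [MeasureTheory.integral_sub (hexp n) (hJ2 n),
        integral_exp_mul_Ioi (by simp; linarith [n.cast_nonneg (α := ℝ)])]
      rw [hfr, mul_zero, exp_zero, neg_div_neg_eq, sub_zero, smul_eq_mul, mul_one]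
    have hJnn : ∀ n, ∀ u ∈ Set.Ioi (0 : ℝ), ‖J n u‖ = J n u := by
      intro n u hu
      have hu' : 0 < u := hu
      refine norm_of_nonneg (mul_nonneg (exp_pos _).le (sub_nonneg.2 ?_))
      exact (div_le_one hu').2 (hlt u hu).2
    have h := MeasureTheory.hasSum_integral_of_summable_integral_norm
      (μ := MeasureTheory.volume.restrict (Set.Ioi (0 : ℝ))) hJint (by
        simp only [MeasureTheory.setIntegral_congr_fun measurableSet_Ioi (hJnn _), hJval]
        exact hasSum_inv_sub_log_eulerMascheroniConstant.summable)
    simp only [hJval] at h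
    rw [← h.unique hasSum_inv_sub_log_eulerMascheroniConstant]
    refine MeasureTheory.setIntegral_congr_fun measurableSet_Ioi fun u hu => ?_
    obtain ⟨h1, h2⟩ := hlt u hu
    have hu' : u ≠ 0 := ne_of_gt hu
    have h3 := ((hasSum_geometric_of_lt_one (exp_pos (-u)).le (by linarith)).mul_left
        (exp (-u) * (1 - (1 - exp (-u)) / u))).tsum_eq
    have h4 : ∀ n : ℕ, J n u = exp (-u) * (1 - (1 - exp (-u)) / u) * exp (-u) ^ n := by
      intro n
      change exp (-((n : ℝ) + 1) * u) * _ = _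
      rw [← exp_nat_mul, show -((n : ℝ) + 1) * u = -u + n * -u by ring, exp_add]
      ring
    simp only [h4]
    rw [h3]
    field_simp

theorem integral_pow_mul_exp_neg_two_pi (m : ℕ) :
    MeasureTheory.IntegrableOn (fun x : ℝ => x ^ m * exp (-(2 * π * x))) (Set.Ioi 0) ∧
      ∫ x in Set.Ioi (0 : ℝ), x ^ m * exp (-(2 * π * x)) = m.factorial / (2 * π) ^ (m + 1) := by
  have h1 := integral_rpow_mul_exp_neg_mul_Ioi (a := m + 1) (by positivity) two_pi_pos
  have h2 := integrableOn_rpow_mul_exp_neg_mul_rpow (s := m) (p := 1)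
    (by linarith [m.cast_nonneg (α := ℝ)]) one_pos two_pi_pos
  simp only [rpow_one, rpow_natCast, neg_mul, add_sub_cancel_right] at h1 h2
  refine ⟨h2, h1.trans ?_⟩
  rw [Gamma_nat_eq_factorial, show (m : ℝ) + 1 = ((m + 1 : ℕ) : ℝ) by push_cast; rfl, rpow_natCast,
    one_div, inv_pow, mul_comm, div_eq_mul_inv]

theorem integral_im_ascPochhammer_mul_exp (n : ℕ) :
    MeasureTheory.IntegrableOn (fun x : ℝ =>
      ((ascPochhammer ℂ n).eval (x * Complex.I)).im * exp (-(2 * π * x))) (Set.Ioi 0) ∧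
      ∫ x in Set.Ioi (0 : ℝ),
        ((ascPochhammer ℂ n).eval (x * Complex.I)).im * exp (-(2 * π * x)) =
      1 / (2 * π) * ∑ k ∈ range (n / 2 + 1), (-1 : ℝ) ^ k * (Nat.factorial (2 * k + 1)) *
        (S1 n (2 * k + 1)) / (2 * π) ^ (2 * k + 1) := by
  simp only [im_ascPochhammer_eval_mul_I, sum_mul, mul_assoc _ _ (exp _)]
  have hI : ∀ k ∈ range (n / 2 + 1), MeasureTheory.Integrable (fun x : ℝ =>
      (-1) ^ k * (S1 n (2 * k + 1) : ℝ) * (x ^ (2 * k + 1) * exp (-(2 * π * x))))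
      (MeasureTheory.volume.restrict (Set.Ioi 0)) :=
    fun k _ => (integral_pow_mul_exp_neg_two_pi _).1.const_mul _
  refine ⟨MeasureTheory.integrable_finsetSum _ hI, ?_⟩
  rw [MeasureTheory.integral_finsetSum _ hI, mul_sum]
  refine sum_congr rfl fun k _ => ?_
  rw [MeasureTheory.integral_const_mul, (integral_pow_mul_exp_neg_two_pi _).2, pow_succ _ (2 * k + 1)]
  field_simp

/-- Euler's constant `γ` equals
`1/2 + (1/π) Σ_{n≥1} (1/(n·n!)) Σ_{k=0}^{⌊n/2⌋} (−1)^k (2k+1)! |S₁(n,2k+1)| / (2π)^{2k+1}`,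
the series being convergent. -/
theorem euler_constant_series_pi :
    HasSum (fun n : ℕ =>
      (1 / Real.pi) *
        ((1 : ℝ) / ((n + 1) * Nat.factorial (n + 1)) *
          ∑ k ∈ Finset.range ((n + 1) / 2 + 1),
            (-1 : ℝ) ^ k * (Nat.factorial (2 * k + 1)) * (S1 (n + 1) (2 * k + 1)) /
              (2 * Real.pi) ^ (2 * k + 1)))
      (Real.eulerMascheroniConstant - 1 / 2) := by
  have hπ := pi_pos
  have h := MeasureTheory.hasSum_integral_of_summable_integral_norm
    (μ := MeasureTheory.volume.restrict (Set.Ioi (0 : ℝ)))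
    (F := fun (n : ℕ) x => 2 / (((n : ℝ) + 1) * (n + 1).factorial) *
      (((ascPochhammer ℂ (n + 1)).eval (x * Complex.I)).im * exp (-(2 * π * x))))
    (fun n => (integral_im_ascPochhammer_mul_exp (n + 1)).1.const_mul _) ?_
  · convert! h using 1
    · funext n
      rw [MeasureTheory.integral_const_mul, (integral_im_ascPochhammer_mul_exp (n + 1)).2]
      field_simp
    · set H : ℝ → ℝ := fun u => exp (-u) * (1 / (1 - exp (-u)) - 1 / u) - 1 / 2 * exp (-u) with hH
      have hHint : ∫ u in Set.Ioi (0 : ℝ), H u = eulerMascheroniConstant - 1 / 2 := by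
        have hexp : MeasureTheory.IntegrableOn (fun u : ℝ => exp (-u)) (Set.Ioi 0) :=
          integrableOn_exp_neg_Ioi 0
        rw [MeasureTheory.integral_sub integral_eulerMascheroni_kernel.1 (hexp.const_mul _),
          integral_eulerMascheroni_kernel.2, MeasureTheory.integral_const_mul,
          integral_exp_neg_Ioi]
        simp
      have hs := MeasureTheory.integral_comp_mul_left_Ioi H 0 two_pi_pos
      rw [mul_zero, hHint, smul_eq_mul] at hs
      have hs' : eulerMascheroniConstant - 1 / 2 =
          ∫ x in Set.Ioi (0 : ℝ), 2 * π * H (2 * π * x) := by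
        rw [MeasureTheory.integral_const_mul, hs]
        field_simp
      rw [hs']
      refine MeasureTheory.setIntegral_congr_fun measurableSet_Ioi fun x hx => ?_
      have hx' : 0 < x := hx
      have h1 := ((hasSum_im_ascPochhammer_div x hx).mul_left (exp (-(2 * π * x)) * 2)).tsum_eq
      have h2 := integral_sin_mul_eq x hx
      have h3 : 1 - exp (-(2 * π * x)) ≠ 0 := by
        have : exp (-(2 * π * x)) < 1 := exp_lt_one_iff.2 (by simpa using by positivity)
        linarith
      rw [mul_assoc (exp _), h2] at h1
      refine Eq.trans ?_ (h1.symm.trans (tsum_congr fun n => ?_))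
      · simp only [hH]
        field_simp
        ring
      · field_simp
  · have hI : MeasureTheory.IntegrableOn (fun x : ℝ => x * exp (-(π * x))) (Set.Ioi 0) := by
      simpa only [rpow_one, neg_mul] using
        integrableOn_rpow_mul_exp_neg_mul_rpow (s := 1) (p := 1) (by norm_num) one_pos pi_pos
    refine Summable.of_nonneg_of_le
      (fun n => MeasureTheory.integral_nonneg fun s => norm_nonneg _) (fun n => ?_)
      (((summable_nat_add_iff 1).2 (summable_one_div_nat_pow.2 one_lt_two)).mul_right
        (2 * ∫ x in Set.Ioi (0 : ℝ), x * exp (-(π * x))))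
    rw [← MeasureTheory.integral_const_mul, ← MeasureTheory.integral_const_mul]
    refine MeasureTheory.setIntegral_mono_on
      ((integral_im_ascPochhammer_mul_exp (n + 1)).1.const_mul _).norm
      ((hI.const_mul _).const_mul _) measurableSet_Ioi fun x hx => ?_
    have hb := (Complex.abs_im_le_norm _).trans (norm_ascPochhammer_eval_mul_I_le hx n)
    have hf : (0 : ℝ) < n.factorial := by exact_mod_cast n.factorial_pos
    rw [norm_mul, norm_mul, norm_of_nonneg (by positivity), norm_eq_abs, norm_eq_abs, abs_exp,
      Nat.factorial_succ]
    have he : exp (-(π * x)) = exp (π * x) * exp (-(2 * π * x)) := by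
      rw [← exp_add]; ring_nf
    rw [he]
    push_cast
    calc _ ≤ 2 / (((n : ℝ) + 1) * (((n : ℝ) + 1) * n.factorial)) *
          (n.factorial * (x * exp (π * x)) * exp (-(2 * π * x))) := by gcongr
      _ = _ := by field_simp
end

section
/- For every integer N ≥ 1 there exists θ ∈ (0,1) (depending on N) such that the second Stieltjes constant satisfies γ₂ = (1/2)·Σ_{k=1}^{N} B_{2k}·( H_{2k−1}² − H_{2k−1}^{(2)} )/k + θ · B_{2N+2}·( H_{2N+1}² − H_{2N+1}^{(2)} )/(2N+2). -/
open Finset Filter Real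

/-- The `n`-th harmonic number `H_n = Σ_{k=1}^n 1/k`. -/
noncomputable def H (n : ℕ) : ℝ := ∑ k ∈ Finset.range n, (1 : ℝ) / (k + 1)

/-- The `n`-th generalized harmonic number of order `s`: `H_n^{(s)} = Σ_{k=1}^n k^{−s}`. -/
noncomputable def Hgen (n s : ℕ) : ℝ := ∑ k ∈ Finset.range n, (1 : ℝ) / ((k + 1) : ℝ) ^ s

open MeasureTheory

/-- For exponent at least `5`, the rational function `t ^ M / (t ^ 2 + C)` is strictly convex on the
positive half-line. -/
lemma strictConvexOn_pow_div_sq_add (n : ℕ) {C : ℝ} (hC : 0 < C) :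
    StrictConvexOn ℝ (Set.Ioi (0 : ℝ)) (fun t => t ^ (n + 5) / (t ^ 2 + C)) := by
  have hpos : ∀ t : ℝ, t ^ 2 + C ≠ 0 := fun t => by positivity
  have hden : ∀ t : ℝ, HasDerivAt (fun t => t ^ 2 + C) (2 * t) t := fun t => by
    simpa using (hasDerivAt_pow 2 t).add_const C
  have hd1 : ∀ t : ℝ, HasDerivAt (fun t => t ^ (n + 5) / (t ^ 2 + C))
      (((n + 3) * t ^ (n + 6) + (n + 5) * C * t ^ (n + 4)) / (t ^ 2 + C) ^ 2) t := fun t => by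
    have h := (hasDerivAt_pow (n + 5) t).div (hden t) (hpos t)
    refine h.congr_deriv ?_
    have := hpos t
    push_cast
    field_simp
    ring
  have hd2 : ∀ t : ℝ, HasDerivAt
      (fun t => ((n + 3) * t ^ (n + 6) + (n + 5) * C * t ^ (n + 4)) / (t ^ 2 + C) ^ 2)
      (t ^ (n + 3) * ((n + 3) * (n + 2) * t ^ 4 + (2 * n ^ 2 + 14 * n + 18) * t ^ 2 * C
        + (n + 5) * (n + 4) * C ^ 2) / (t ^ 2 + C) ^ 3) t := fun t => by
    have h := ((((hasDerivAt_pow (n + 6) t).const_mul ((n : ℝ) + 3)).add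
      ((hasDerivAt_pow (n + 4) t).const_mul (((n : ℝ) + 5) * C)))).div
      ((hden t).pow 2) (pow_ne_zero 2 (hpos t))
    refine h.congr_deriv ?_
    have := hpos t
    push_cast
    simp only [Pi.add_apply, Pi.pow_apply]
    field_simp
    ring
  refine strictConvexOn_of_deriv2_pos' (convex_Ioi 0)
    (fun t _ => (hd1 t).continuousAt.continuousWithinAt) fun t ht => ?_
  have ht : 0 < t := ht
  rw [Function.iterate_succ_apply, Function.iterate_one, funext fun t => (hd1 t).deriv,
    (hd2 t).deriv]
  positivity

/-- A function that is strictly convex on `(0, ∞)` lies strictly on the expected side of each of its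
secant lines. -/
lemma StrictConvexOn.exists_secant {W : ℝ → ℝ} (hW : StrictConvexOn ℝ (Set.Ioi (0 : ℝ)) W)
    {u v : ℝ} (hu : 0 < u) (huv : u < v) :
    ∃ a b : ℝ, ∀ t, 0 < t → t ≠ u → t ≠ v → 0 < (t - u) * (t - v) * (W t - (a + b * t)) := by
  have hv : 0 < v := hu.trans huv
  have hvu : 0 < v - u := sub_pos.2 huv
  refine ⟨W u - (W v - W u) / (v - u) * u, (W v - W u) / (v - u), fun t ht htu htv => ?_⟩
  have key : (v - u) * (W t - (W u - (W v - W u) / (v - u) * u + (W v - W u) / (v - u) * t)) =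
      (v - u) * W t - (v - t) * W u - (t - u) * W v := by
    field_simp
    ring
  set D := W t - (W u - (W v - W u) / (v - u) * u + (W v - W u) / (v - u) * t)
  rcases lt_or_gt_of_ne htu with h1 | h1
  · have h := hW.slope_strict_mono_adjacent ht hv h1 huv
    rw [div_lt_div_iff₀ (by linarith) (by linarith)] at h
    have : 0 < (v - u) * D := by rw [key]; linarith
    exact mul_pos (mul_pos_of_neg_of_neg (by linarith) (by linarith))
      (pos_of_mul_pos_right this hvu.le)
  · rcases lt_or_gt_of_ne htv with h2 | h2
    · have h := hW.slope_strict_mono_adjacent hu hv h1 h2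
      rw [div_lt_div_iff₀ (by linarith) (by linarith)] at h
      have : (v - u) * D < 0 := by rw [key]; linarith
      exact mul_pos_of_neg_of_neg (mul_neg_of_pos_of_neg (by linarith) (by linarith))
        (neg_of_mul_neg_right this hvu.le)
    · have h := hW.slope_strict_mono_adjacent hu ht huv h2
      rw [div_lt_div_iff₀ (by linarith) (by linarith)] at h
      have : 0 < (v - u) * D := by rw [key]; linarith
      exact mul_pos (mul_pos (by linarith) (by linarith)) (pos_of_mul_pos_right this hvu.le)

/-- The expansion `1/(e^t - 1) = 1/t - 1/2 + ∑ 2t/(t² + (2πk)²)`. -/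
lemma hasSum_inv_exp_sub_one {t : ℝ} (ht : 0 < t) :
    HasSum (fun k : ℕ => 2 * t / (t ^ 2 + (2 * π * (k + 1)) ^ 2))
      (1 / (exp t - 1) - 1 / t + 1 / 2) := by
  set x : ℂ := Complex.I * (t / (2 * π)) with hx
  have hpi : (π : ℂ) ≠ 0 := by exact_mod_cast Real.pi_ne_zero
  have htc : (t : ℂ) ≠ 0 := by exact_mod_cast ht.ne'
  have hxz : x ∈ Complex.integerComplement := by
    rintro ⟨n, hn⟩
    have := congrArg Complex.im hn
    have h2 : x.im = t / (2 * π) := by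
      rw [hx, show (t / (2 * π) : ℂ) = ((t / (2 * π) : ℝ) : ℂ) by push_cast; rfl,
        Complex.I_mul_im, Complex.ofReal_re]
    rw [h2, Complex.intCast_im] at this
    exact (by positivity : (0 : ℝ) < t / (2 * π)).ne this
  have hs : HasSum (fun n => cotTerm x n) (π * Complex.cot (π * x) - 1 / x) := by
    rw [cot_series_rep' hxz]
    exact (summable_cotTerm hxz).hasSum
  have hs2 := hs.mul_left (Complex.I / (2 * π))
  have hterm : ∀ k : ℕ, Complex.I / (2 * π) * cotTerm x k =
      ((2 * t / (t ^ 2 + (2 * π * (k + 1)) ^ 2) : ℝ) : ℂ) := fun k => by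
    rw [cotTerm_identity hxz]
    have h1 : (x + (k + 1)) * (x - (k + 1)) = -((t ^ 2 + (2 * π * (k + 1)) ^ 2) / (2 * π) ^ 2) := by
      rw [hx]
      field_simp
      linear_combination (t:ℂ)^2 * Complex.I_sq
    have h2 : ((t : ℂ) ^ 2 + (2 * π * (k + 1)) ^ 2) ≠ 0 := by
      have : (t ^ 2 + (2 * π * (k + 1)) ^ 2 : ℝ) ≠ 0 := by positivity
      exact_mod_cast this
    rw [h1, hx]
    push_cast
    field_simp
    rw [Complex.I_sq]
    ring
  have hexp : Complex.exp (2 * π * Complex.I * x) = Complex.exp (-t) := by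
    congr 1
    rw [hx]
    field_simp
    linear_combination Complex.I_sq
  have hval : Complex.I / (2 * π) * (π * Complex.cot (π * x) - 1 / x) =
      ((1 / (exp t - 1) - 1 / t + 1 / 2 : ℝ) : ℂ) := by
    rw [Complex.cot_pi_eq_exp_ratio, hexp, Complex.exp_neg, hx]
    have h1 : Complex.exp t ≠ 0 := Complex.exp_ne_zero _
    have h2 : Complex.exp t - 1 ≠ 0 := by
      have : exp t - 1 ≠ 0 := by
        have := Real.add_one_lt_exp ht.ne'
        intro h; linarith
      exact_mod_cast this
    push_cast
    have h3 : (1 - (Complex.exp t)⁻¹) = (Complex.exp t - 1) / Complex.exp t := by field_simp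
    rw [h3]
    field_simp
    ring
  rw [hval] at hs2
  simp_rw [hterm] at hs2
  exact_mod_cast hs2

/-- The remainder of the expansion of `1/(e^t - 1)` in Bernoulli numbers. -/
noncomputable def bernoulliRemainder (N : ℕ) (t : ℝ) : ℝ :=
  1 / (exp t - 1) - 1 / t + 1 / 2 -
    ∑ k ∈ Finset.Icc 1 N, ((bernoulli (2 * k) : ℚ) : ℝ) / (2 * k).factorial * t ^ (2 * k - 1)

lemma bernoulliRemainder_succ (N : ℕ) (t : ℝ) :
    bernoulliRemainder (N + 1) t = bernoulliRemainder N t -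
      ((bernoulli (2 * (N + 1)) : ℚ) : ℝ) / (2 * (N + 1)).factorial * t ^ (2 * N + 1) := by
  rw [bernoulliRemainder, bernoulliRemainder, Finset.sum_Icc_succ_top (by omega),
    show 2 * (N + 1) - 1 = 2 * N + 1 by omega]
  ring

lemma hasSum_inv_two_pi_pow (N : ℕ) :
    HasSum (fun k : ℕ => 2 / (2 * π * (k + 1)) ^ (2 * N + 2))
      ((-1) ^ N * ((bernoulli (2 * (N + 1)) : ℚ) : ℝ) / (2 * (N + 1)).factorial) := by
  have h := hasSum_zeta_nat (k := N + 1) (by omega)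
  rw [← hasSum_nat_add_iff' 1] at h
  have h2 := h.mul_left (2 / (2 * π) ^ (2 * N + 2))
  convert! h2 using 1
  · funext k
    push_cast
    rw [mul_pow (2 * π)]
    field_simp
    ring
  · rw [show 2 * (N + 1) - 1 = 2 * N + 1 by omega]
    simp only [Finset.sum_range_one]
    rw [show 2 * (N + 1) = 2 * N + 2 by omega]
    simp only [Nat.cast_zero, zero_pow (show 2 * N + 2 ≠ 0 by omega), div_zero, sub_zero]
    rw [mul_pow]
    field_simp
    ring

lemma hasSum_bernoulliRemainder (N : ℕ) {t : ℝ} (ht : 0 < t) :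
    HasSum (fun k : ℕ => 2 / (2 * π * (k + 1)) ^ (2 * N) *
        (t ^ (2 * N + 1) / (t ^ 2 + (2 * π * (k + 1)) ^ 2)))
      ((-1) ^ N * bernoulliRemainder N t) := by
  induction N with
  | zero =>
    simpa [bernoulliRemainder, mul_div_assoc] using hasSum_inv_exp_sub_one ht
  | succ N ih =>
    have h := ((hasSum_inv_two_pi_pow N).mul_right (t ^ (2 * N + 1))).sub ih
    convert! h using 1
    · funext k
      have : (0 : ℝ) < 2 * π * (k + 1) := by positivity
      field_simp
      ring
    · rw [bernoulliRemainder_succ]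
      ring

lemma strictConvexOn_bernoulliRemainder {N : ℕ} (hN : 2 ≤ N) :
    StrictConvexOn ℝ (Set.Ioi (0 : ℝ)) (fun t => (-1) ^ N * bernoulliRemainder N t) := by
  obtain ⟨n, hn⟩ : ∃ n, 2 * N + 1 = n + 5 := ⟨2 * N - 4, by omega⟩
  refine ⟨convex_Ioi 0, fun x hx y hy hxy a b ha hb hab => ?_⟩
  have hz : 0 < a • x + b • y := (convex_Ioi (0 : ℝ)) hx hy ha.le hb.le hab
  have key : ∀ k : ℕ, 2 / (2 * π * (k + 1)) ^ (2 * N) *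
        ((a • x + b • y) ^ (2 * N + 1) / ((a • x + b • y) ^ 2 + (2 * π * (k + 1)) ^ 2)) <
      a * (2 / (2 * π * (k + 1)) ^ (2 * N) *
        (x ^ (2 * N + 1) / (x ^ 2 + (2 * π * (k + 1)) ^ 2))) +
      b * (2 / (2 * π * (k + 1)) ^ (2 * N) *
        (y ^ (2 * N + 1) / (y ^ 2 + (2 * π * (k + 1)) ^ 2))) := fun k => by
    have h := (strictConvexOn_pow_div_sq_add n (C := (2 * π * (k + 1)) ^ 2) (by positivity)).2
      hx hy hxy ha hb hab
    rw [hn]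
    have hc : (0 : ℝ) < 2 / (2 * π * (k + 1)) ^ (2 * N) := by positivity
    have h' := mul_lt_mul_of_pos_left h hc
    simp only [smul_eq_mul] at h' ⊢
    linarith
  exact hasSum_lt (fun k => (key k).le) (key 0) (hasSum_bernoulliRemainder N hz)
    (((hasSum_bernoulliRemainder N hx).mul_left a).add
      ((hasSum_bernoulliRemainder N hy).mul_left b))

lemma sq_log_le {t : ℝ} (ht : 0 < t) : log t ^ 2 ≤ t ^ 2 + 16 * t ^ (-(1 / 2) : ℝ) := by
  have hr : 0 < t ^ (-(1 / 2) : ℝ) := rpow_pos_of_pos ht _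
  rcases le_total 1 t with h | h
  · nlinarith [log_nonneg h, log_le_self ht.le]
  · have h1 : -log t ≤ 4 * t ^ (-(1 / 4) : ℝ) := by
      have := log_le_rpow_div (inv_pos.2 ht).le (show (0 : ℝ) < 1 / 4 by norm_num)
      rw [log_inv, inv_rpow ht.le, ← rpow_neg ht.le] at this
      linarith
    have h2 : (t ^ (-(1 / 4) : ℝ)) ^ 2 = t ^ (-(1 / 2) : ℝ) := by
      rw [← rpow_natCast, ← rpow_mul ht.le]
      norm_num
    nlinarith [log_nonpos ht.le h, sq_nonneg t]

lemma integrableOn_exp_neg_mul_pow (m : ℕ) :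
    IntegrableOn (fun t : ℝ => exp (-t) * t ^ m) (Set.Ioi 0) := by
  refine (GammaIntegral_convergent (s := m + 1) (by positivity)).congr_fun (fun t _ => ?_)
    measurableSet_Ioi
  simp

lemma continuousOn_exp_neg_mul_pow_mul_log_pow (m j : ℕ) :
    ContinuousOn (fun t : ℝ => exp (-t) * t ^ m * log t ^ j) (Set.Ioi 0) := by
  have : ContinuousOn log (Set.Ioi 0) := continuousOn_log.mono fun t ht => (ne_of_gt ht)
  fun_prop

lemma integrableOn_exp_neg_mul_pow_mul_log_pow (m : ℕ) {j : ℕ} (hj : j ≤ 2) :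
    IntegrableOn (fun t : ℝ => exp (-t) * t ^ m * log t ^ j) (Set.Ioi 0) := by
  have hb : IntegrableOn (fun t : ℝ => exp (-t) * t ^ m + (exp (-t) * t ^ (m + 2) +
      16 * (exp (-t) * t ^ ((m + 1 / 2 : ℝ) - 1)))) (Set.Ioi 0) :=
    (integrableOn_exp_neg_mul_pow m).add ((integrableOn_exp_neg_mul_pow (m + 2)).add
      ((GammaIntegral_convergent (by positivity)).const_mul 16))
  refine hb.mono' ((continuousOn_exp_neg_mul_pow_mul_log_pow m j).aestronglyMeasurable
    measurableSet_Ioi) ?_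
  filter_upwards [ae_restrict_mem measurableSet_Ioi] with t ht
  have ht : 0 < t := ht
  have h1 : |log t ^ j| ≤ 1 + log t ^ 2 := by
    rw [abs_le]
    interval_cases j
    · constructor <;> nlinarith [sq_nonneg (log t)]
    · constructor <;> nlinarith [sq_nonneg (log t - 1), sq_nonneg (log t + 1)]
    · constructor <;> nlinarith [sq_nonneg (log t)]
  have h2 : t ^ m * t ^ (-(1 / 2) : ℝ) = t ^ ((m + 1 / 2 : ℝ) - 1) := by
    rw [← rpow_natCast, ← rpow_add ht]
    congr 1
    ring
  rw [norm_mul, Real.norm_of_nonneg (by positivity), Real.norm_eq_abs, ← h2]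
  have h3 := mul_le_mul_of_nonneg_left (h1.trans (add_le_add_right (sq_log_le ht) 1))
    (show 0 ≤ exp (-t) * t ^ m by positivity)
  refine h3.trans_eq ?_
  ring

/-- The integral `∫₀^∞ e^{-t} t^m log^j t dt`, the `j`-th derivative of the Gamma function at
`m + 1`. -/
noncomputable def gammaLogMoment (m j : ℕ) : ℝ :=
  ∫ t in Set.Ioi (0 : ℝ), exp (-t) * t ^ m * log t ^ j

lemma gammaLogMoment_succ_aux (m : ℕ) {j : ℕ} (hj : j ≤ 2) (D : ℝ → ℝ) (c : ℝ)
    (hD : ∀ t, 0 < t → HasDerivAt (fun t => log t ^ j) (D t / t) t)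
    (hDi : IntegrableOn (fun t => exp (-t) * t ^ m * D t) (Set.Ioi 0))
    (hc : ∫ t in Set.Ioi (0 : ℝ), exp (-t) * t ^ m * D t = c) :
    gammaLogMoment (m + 1) j = (m + 1) * gammaLogMoment m j + c := by
  have hI := integrableOn_exp_neg_mul_pow_mul_log_pow m hj
  have hI' := integrableOn_exp_neg_mul_pow_mul_log_pow (m + 1) hj
  have hder : ∀ t ∈ Set.Ioi (0 : ℝ), HasDerivAt (fun t => exp (-t) * t ^ (m + 1) * log t ^ j)
      ((m + 1) * (exp (-t) * t ^ m * log t ^ j) + exp (-t) * t ^ m * D t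
        - exp (-t) * t ^ (m + 1) * log t ^ j) t := fun t ht => by
    have ht : 0 < t := ht
    refine ((((hasDerivAt_neg t).exp).mul (hasDerivAt_pow (m + 1) t)).mul (hD t ht)).congr_deriv ?_
    push_cast
    simp only [Pi.mul_apply]
    field_simp
    ring
  have hsum : IntegrableOn (fun t => (m + 1) * (exp (-t) * t ^ m * log t ^ j) +
      exp (-t) * t ^ m * D t) (Set.Ioi 0) := (hI.const_mul ((m : ℝ) + 1)).add hDi
  have hint := hsum.sub hI'
  have hzero : ContinuousWithinAt (fun t => exp (-t) * t ^ (m + 1) * log t ^ j)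
      (Set.Ici 0) 0 := by
    rw [← continuousWithinAt_Ioi_iff_Ici]
    have h0 : Tendsto (fun t : ℝ => t ^ (1 : ℕ) * log t ^ j) (nhdsWithin 0 (Set.Ioi 0))
        (nhds 0) := by
      have hid : Tendsto (fun t : ℝ => t) (nhdsWithin 0 (Set.Ioi 0)) (nhds 0) :=
        tendsto_nhdsWithin_of_tendsto_nhds tendsto_id
      interval_cases j
      · simpa using hid
      · simpa [mul_comm] using tendsto_log_mul_rpow_nhdsGT_zero one_pos
      · have h := (tendsto_log_mul_rpow_nhdsGT_zero (show (0 : ℝ) < 1 / 2 by norm_num)).pow 2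
        rw [zero_pow two_ne_zero] at h
        refine h.congr' ?_
        filter_upwards [self_mem_nhdsWithin] with t ht
        have ht : 0 < t := ht
        rw [mul_pow, ← rpow_natCast (t ^ (1 / 2 : ℝ)), ← rpow_mul ht.le]
        norm_num
        ring
    have h1 : Tendsto (fun t : ℝ => exp (-t) * t ^ m) (nhdsWithin 0 (Set.Ioi 0))
        (nhds (exp (-0) * 0 ^ m)) :=
      (Continuous.tendsto (by fun_prop) 0).mono_left nhdsWithin_le_nhds
    have h2 := h1.mul h0
    rw [mul_zero] at h2
    simp only [ContinuousWithinAt, zero_pow (Nat.succ_ne_zero m), mul_zero, zero_mul]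
    refine h2.congr fun t => ?_
    ring
  have h := integral_Ioi_of_hasDerivAt_of_tendsto hzero hder hint
    (tendsto_zero_of_hasDerivAt_of_integrableOn_Ioi hder hint hI')
  rw [integral_sub hsum hI', integral_add (hI.const_mul _) hDi, integral_const_mul, hc] at h
  simp only [zero_pow (Nat.succ_ne_zero m), mul_zero, zero_mul, sub_zero] at h
  rw [gammaLogMoment, gammaLogMoment]
  linarith

lemma gammaLogMoment_succ_zero (m : ℕ) :
    gammaLogMoment (m + 1) 0 = (m + 1) * gammaLogMoment m 0 := by
  have := gammaLogMoment_succ_aux m (j := 0) (by norm_num) (fun _ => 0) 0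
    (fun t _ => by simpa using hasDerivAt_const t (1 : ℝ)) (by simp) (by simp)
  simpa using this

lemma gammaLogMoment_succ_one (m : ℕ) :
    gammaLogMoment (m + 1) 1 = (m + 1) * gammaLogMoment m 1 + gammaLogMoment m 0 :=
  gammaLogMoment_succ_aux m (by norm_num) (fun t => log t ^ 0) _
    (fun t ht => by simpa using hasDerivAt_log ht.ne')
    (integrableOn_exp_neg_mul_pow_mul_log_pow m (by norm_num)) rfl

lemma gammaLogMoment_succ_two (m : ℕ) :
    gammaLogMoment (m + 1) 2 = (m + 1) * gammaLogMoment m 2 + 2 * gammaLogMoment m 1 :=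
  gammaLogMoment_succ_aux m le_rfl (fun t => 2 * log t ^ 1) _
    (fun t ht => ((hasDerivAt_log ht.ne').pow 2).congr_deriv (by simp; ring))
    (IntegrableOn.congr_fun
      ((integrableOn_exp_neg_mul_pow_mul_log_pow m (j := 1) (by norm_num)).const_mul 2)
      (fun t _ => by ring) measurableSet_Ioi)
    (by rw [gammaLogMoment, ← integral_const_mul]; congr 1; ext t; ring)

lemma gammaLogMoment_zero (m : ℕ) : gammaLogMoment m 0 = m.factorial := by
  induction m with
  | zero => simpa [gammaLogMoment] using integral_exp_neg_Ioi 0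
  | succ m ih =>
    rw [gammaLogMoment_succ_zero, ih, Nat.factorial_succ]
    push_cast
    ring

lemma H_succ (m : ℕ) : H (m + 1) = H m + 1 / (m + 1) := by
  simp [H, Finset.sum_range_succ]

lemma Hgen_two_succ (m : ℕ) : Hgen (m + 1) 2 = Hgen m 2 + 1 / ((m : ℝ) + 1) ^ 2 := by
  simp [Hgen, Finset.sum_range_succ]

lemma gammaLogMoment_one (m : ℕ) :
    gammaLogMoment m 1 = m.factorial * (gammaLogMoment 0 1 + H m) := by
  induction m with
  | zero => simp [H]
  | succ m ih =>
    rw [gammaLogMoment_succ_one, gammaLogMoment_zero, ih, Nat.factorial_succ, H_succ]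
    push_cast
    field_simp
    ring

lemma gammaLogMoment_two (m : ℕ) :
    gammaLogMoment m 2 = m.factorial *
      (gammaLogMoment 0 2 + 2 * gammaLogMoment 0 1 * H m + (H m ^ 2 - Hgen m 2)) := by
  induction m with
  | zero => simp [H, Hgen]
  | succ m ih =>
    rw [gammaLogMoment_succ_two, gammaLogMoment_one, ih, Nat.factorial_succ, H_succ,
      Hgen_two_succ]
    push_cast
    field_simp
    ring

lemma integrableOn_exp_neg_mul_pow_mul_log_quadratic (m : ℕ) (a b : ℝ) :
    IntegrableOn (fun t : ℝ => exp (-t) * t ^ m * (log t ^ 2 + a * log t + b)) (Set.Ioi 0) := by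
  refine IntegrableOn.congr_fun
    (((integrableOn_exp_neg_mul_pow_mul_log_pow m le_rfl).add
      ((integrableOn_exp_neg_mul_pow_mul_log_pow m one_le_two).const_mul a)).add
      ((integrableOn_exp_neg_mul_pow_mul_log_pow m zero_le_two).const_mul b))
    (fun t _ => ?_) measurableSet_Ioi
  simp only [Pi.add_apply]
  ring

lemma integral_exp_neg_mul_pow_mul_log_quadratic (m : ℕ) (a b : ℝ) :
    ∫ t in Set.Ioi (0 : ℝ), exp (-t) * t ^ m * (log t ^ 2 + a * log t + b) =
      gammaLogMoment m 2 + a * gammaLogMoment m 1 + b * gammaLogMoment m 0 := by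
  have h2 := integrableOn_exp_neg_mul_pow_mul_log_pow m (j := 2) le_rfl
  have h1 := (integrableOn_exp_neg_mul_pow_mul_log_pow m (j := 1) one_le_two).const_mul a
  have h0 := (integrableOn_exp_neg_mul_pow_mul_log_pow m (j := 0) zero_le_two).const_mul b
  have h21 : IntegrableOn (fun t : ℝ => exp (-t) * t ^ m * log t ^ 2 +
      a * (exp (-t) * t ^ m * log t ^ 1)) (Set.Ioi 0) := h2.add h1
  rw [gammaLogMoment, gammaLogMoment, gammaLogMoment, ← integral_const_mul, ← integral_const_mul,
    ← integral_add h2 h1, ← integral_add h21 h0]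
  congr 1
  ext t
  ring

/-- The function whose Laplace transform is `log² x / x`. -/
noncomputable def laplaceWeight (t : ℝ) : ℝ :=
  log t ^ 2 + -2 * gammaLogMoment 0 1 * log t +
    (2 * gammaLogMoment 0 1 ^ 2 - gammaLogMoment 0 2)

lemma integrableOn_exp_neg_mul_pow_mul_laplaceWeight (m : ℕ) :
    IntegrableOn (fun t : ℝ => exp (-t) * t ^ m * laplaceWeight t) (Set.Ioi 0) :=
  integrableOn_exp_neg_mul_pow_mul_log_quadratic m _ _

lemma integral_exp_neg_mul_pow_mul_laplaceWeight (m : ℕ) :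
    ∫ t in Set.Ioi (0 : ℝ), exp (-t) * t ^ m * laplaceWeight t =
      m.factorial * (H m ^ 2 - Hgen m 2) := by
  simp_rw [laplaceWeight]
  rw [integral_exp_neg_mul_pow_mul_log_quadratic, gammaLogMoment_two m, gammaLogMoment_one m,
    gammaLogMoment_zero m]
  ring

lemma integrableOn_exp_neg_mul_laplaceWeight :
    IntegrableOn (fun t : ℝ => exp (-t) * laplaceWeight t) (Set.Ioi 0) := by
  simpa using integrableOn_exp_neg_mul_pow_mul_laplaceWeight 0

lemma integral_exp_neg_mul_laplaceWeight :
    ∫ t in Set.Ioi (0 : ℝ), exp (-t) * laplaceWeight t = 0 := by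
  simpa [H, Hgen] using integral_exp_neg_mul_pow_mul_laplaceWeight 0

lemma exp_neg_mul_laplaceWeight_eq {x t : ℝ} (hx : 0 < x) (ht : 0 < t) :
    exp (-(x * t)) * (x * t) ^ 0 * (log (x * t) ^ 2 +
      (-2 * log x - 2 * gammaLogMoment 0 1) * log (x * t) + (log x ^ 2 +
        2 * gammaLogMoment 0 1 * log x + (2 * gammaLogMoment 0 1 ^ 2 - gammaLogMoment 0 2))) =
    exp (-(x * t)) * laplaceWeight t := by
  rw [laplaceWeight, log_mul hx.ne' ht.ne']
  ring

lemma integrableOn_exp_neg_mul_mul_laplaceWeight {x : ℝ} (hx : 0 < x) :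
    IntegrableOn (fun t : ℝ => exp (-(x * t)) * laplaceWeight t) (Set.Ioi 0) := by
  have h := integrableOn_exp_neg_mul_pow_mul_log_quadratic 0
    (-2 * log x - 2 * gammaLogMoment 0 1) (log x ^ 2 +
        2 * gammaLogMoment 0 1 * log x + (2 * gammaLogMoment 0 1 ^ 2 - gammaLogMoment 0 2))
  rw [← mul_zero x, ← integrableOn_Ioi_comp_mul_left_iff _ _ hx] at h
  exact h.congr_fun (fun t ht => exp_neg_mul_laplaceWeight_eq hx ht) measurableSet_Ioi

lemma integral_exp_neg_mul_mul_laplaceWeight {x : ℝ} (hx : 0 < x) :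
    ∫ t in Set.Ioi (0 : ℝ), exp (-(x * t)) * laplaceWeight t = log x ^ 2 / x := by
  have h := integral_exp_neg_mul_pow_mul_log_quadratic 0
    (-2 * log x - 2 * gammaLogMoment 0 1) (log x ^ 2 +
        2 * gammaLogMoment 0 1 * log x + (2 * gammaLogMoment 0 1 ^ 2 - gammaLogMoment 0 2))
  rw [← mul_zero x, ← integral_comp_mul_left_Ioi' _ _ hx,
    setIntegral_congr_fun measurableSet_Ioi (fun t ht => exp_neg_mul_laplaceWeight_eq hx ht),
    gammaLogMoment_zero] at h
  rw [eq_div_iff hx.ne', mul_comm]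
  simp only [smul_eq_mul, Nat.factorial_zero, Nat.cast_one] at h
  linarith

lemma integral_log_sq_div {n : ℝ} (hn : 1 ≤ n) :
    ∫ x in (1 : ℝ)..n, log x ^ 2 / x = log n ^ 3 / 3 := by
  have hpos : ∀ x ∈ Set.uIcc 1 n, x ≠ 0 := fun x hx => by
    rw [Set.uIcc_of_le hn] at hx
    exact (zero_lt_one.trans_le hx.1).ne'
  rw [intervalIntegral.integral_eq_sub_of_hasDerivAt (f := fun x => log x ^ 3 / 3)]
  · simp
  · intro x hx
    refine (((hasDerivAt_log (hpos x hx)).pow 3).div_const 3).congr_deriv ?_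
    push_cast
    ring
  · refine ContinuousOn.intervalIntegrable ?_
    have := continuousOn_log.mono hpos
    exact (this.pow 2).div continuousOn_id hpos

lemma integral_exp_neg_mul {t : ℝ} (ht : 0 < t) (n : ℝ) :
    ∫ x in (1 : ℝ)..n, exp (-(x * t)) = (exp (-t) - exp (-(n * t))) / t := by
  rw [intervalIntegral.integral_eq_sub_of_hasDerivAt (f := fun x => -exp (-(x * t)) / t)]
  · rw [one_mul]
    ring
  · intro x _
    refine ((((hasDerivAt_mul_const t).neg).exp.neg).div_const t).congr_deriv ?_
    field_simp
    simp [mul_comm]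
  · exact (by fun_prop : Continuous fun x => exp (-(x * t))).intervalIntegrable _ _

lemma integral_laplaceWeight_mul_exp_sub_exp {n : ℝ} (hn : 1 ≤ n) :
    ∫ t in Set.Ioi (0 : ℝ), (exp (-t) - exp (-(n * t))) / t * laplaceWeight t =
      log n ^ 3 / 3 := by
  rw [← integral_log_sq_div hn, intervalIntegral.integral_of_le hn]
  have hswap : Integrable (Function.uncurry fun x t : ℝ => exp (-(x * t)) * laplaceWeight t)
      ((volume.restrict (Set.Ioc 1 n)).prod (volume.restrict (Set.Ioi 0))) := by
    have hb := integrableOn_exp_neg_mul_laplaceWeight.norm.comp_snd (volume.restrict (Set.Ioc 1 n))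
    refine hb.mono' ?_ ?_
    · have : Measurable laplaceWeight := by
        unfold laplaceWeight
        fun_prop
      refine Measurable.aestronglyMeasurable ?_
      unfold Function.uncurry
      fun_prop
    · rw [Measure.prod_restrict]
      filter_upwards [ae_restrict_mem (measurableSet_Ioc.prod measurableSet_Ioi)] with p hp
      have hx : 1 ≤ p.1 := hp.1.1.le
      have ht : 0 < p.2 := hp.2
      rw [Function.uncurry, norm_mul, norm_mul]
      gcongr
      rw [norm_of_nonneg (exp_pos _).le, norm_of_nonneg (exp_pos _).le, exp_le_exp]
      nlinarith
  have h := integral_integral_swap hswap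
  rw [setIntegral_congr_fun measurableSet_Ioc (fun x hx =>
    integral_exp_neg_mul_mul_laplaceWeight (zero_lt_one.trans hx.1))] at h
  rw [h]
  refine setIntegral_congr_fun measurableSet_Ioi fun t ht => ?_
  rw [integral_mul_const, ← intervalIntegral.integral_of_le hn, integral_exp_neg_mul ht]

lemma bernoulliRemainder_zero (t : ℝ) :
    bernoulliRemainder 0 t = 1 / (exp t - 1) - 1 / t + 1 / 2 := by
  simp [bernoulliRemainder]

lemma bernoulliRemainder_zero_mem_Icc {t : ℝ} (ht : 0 < t) :
    bernoulliRemainder 0 t ∈ Set.Icc (0 : ℝ) (1 / 2) := by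
  constructor
  · rw [bernoulliRemainder_zero]
    exact (hasSum_inv_exp_sub_one ht).nonneg fun k => by positivity
  · rw [bernoulliRemainder_zero]
    have : 1 / (exp t - 1) ≤ 1 / t :=
      one_div_le_one_div_of_le ht (by linarith [add_one_le_exp t])
    linarith

lemma sum_range_exp_neg {t : ℝ} (ht : 0 < t) (n : ℕ) :
    ∑ k ∈ Finset.range n, exp (-((k + 1 : ℝ) * t)) =
      exp (-t) * (bernoulliRemainder 0 t + 1 / 2) -
        exp (-(n * t)) * (bernoulliRemainder 0 t - 1 / 2) + (exp (-t) - exp (-(n * t))) / t := by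
  have h1 : exp t - 1 ≠ 0 := by linarith [add_one_lt_exp ht.ne']
  rw [bernoulliRemainder_zero]
  induction n with
  | zero =>
    simp only [Finset.range_zero, Finset.sum_empty, Nat.cast_zero, zero_mul, neg_zero, exp_zero,
      exp_neg t]
    field_simp
    ring
  | succ n ih =>
    have h2 : exp (-((n + 1 : ℝ) * t)) = exp (-(n * t)) / exp t := by
      rw [← exp_sub]
      ring_nf
    rw [Finset.sum_range_succ, ih]
    push_cast
    rw [h2]
    field_simp
    ring

lemma measurable_laplaceWeight : Measurable laplaceWeight := by
  unfold laplaceWeight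
  fun_prop

lemma measurable_bernoulliRemainder (N : ℕ) : Measurable (bernoulliRemainder N) := by
  unfold bernoulliRemainder
  fun_prop

lemma integrableOn_mul_bernoulliRemainder_zero {g : ℝ → ℝ} (hg : IntegrableOn g (Set.Ioi 0)) :
    IntegrableOn (fun t => g t * bernoulliRemainder 0 t) (Set.Ioi 0) := by
  refine hg.norm.mono' (hg.aestronglyMeasurable.mul
    (measurable_bernoulliRemainder 0).aestronglyMeasurable) ?_
  filter_upwards [ae_restrict_mem measurableSet_Ioi] with t ht
  obtain ⟨h1, h2⟩ := bernoulliRemainder_zero_mem_Icc ht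
  rw [norm_mul, norm_of_nonneg h1]
  nlinarith [norm_nonneg (g t)]

lemma sum_log_sq_div_sub_eq_integral {n : ℕ} (hn : 1 ≤ n) :
    (∑ k ∈ Finset.range n, (log (k + 1)) ^ 2 / (k + 1)) - (log n) ^ 3 / 3 =
      ∫ t in Set.Ioi (0 : ℝ), (exp (-t) * (bernoulliRemainder 0 t + 1 / 2) -
        exp (-(n * t)) * (bernoulliRemainder 0 t - 1 / 2)) * laplaceWeight t := by
  have hn' : (1 : ℝ) ≤ n := by exact_mod_cast hn
  have hk : ∀ k ∈ Finset.range n, IntegrableOn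
      (fun t : ℝ => exp (-((k + 1 : ℝ) * t)) * laplaceWeight t) (Set.Ioi 0) := fun k _ =>
    integrableOn_exp_neg_mul_mul_laplaceWeight (by positivity)
  have hi : IntegrableOn (fun t : ℝ => (exp (-t) - exp (-(n * t))) / t * laplaceWeight t)
      (Set.Ioi 0) := by
    have h1 := integrableOn_exp_neg_mul_laplaceWeight
    have hn := integrableOn_exp_neg_mul_mul_laplaceWeight (zero_lt_one.trans_le hn')
    refine IntegrableOn.congr_fun (((integrable_finsetSum _ hk).sub
      ((integrableOn_mul_bernoulliRemainder_zero h1).add (h1.const_mul (1 / 2)))).add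
      ((integrableOn_mul_bernoulliRemainder_zero hn).sub (hn.const_mul (1 / 2))))
      (fun t ht => ?_) measurableSet_Ioi
    simp only [Pi.add_apply, Pi.sub_apply]
    rw [← Finset.sum_mul, sum_range_exp_neg ht]
    ring
  have hsum : ∑ k ∈ Finset.range n, (log (k + 1)) ^ 2 / (k + 1) = ∑ k ∈ Finset.range n,
      ∫ t in Set.Ioi (0 : ℝ), exp (-((k + 1 : ℝ) * t)) * laplaceWeight t :=
    Finset.sum_congr rfl fun k _ =>
      (integral_exp_neg_mul_mul_laplaceWeight (by positivity)).symm
  rw [← integral_laplaceWeight_mul_exp_sub_exp hn', hsum, ← integral_finsetSum _ hk, ← integral_sub (integrable_finsetSum _ hk) hi]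
  refine setIntegral_congr_fun measurableSet_Ioi fun t ht => ?_
  rw [← Finset.sum_mul, sum_range_exp_neg ht]
  ring

lemma stieltjes_two_eq_integral {γ₂ : ℝ}
    (hγ : Tendsto (fun n : ℕ =>
        (∑ k ∈ Finset.range n, (Real.log (k + 1)) ^ 2 / (k + 1)) - (Real.log n) ^ 3 / 3)
      atTop (nhds γ₂)) :
    γ₂ = ∫ t in Set.Ioi (0 : ℝ), exp (-t) * laplaceWeight t * bernoulliRemainder 0 t := by
  have hlim : Tendsto (fun n : ℕ => ∫ t in Set.Ioi (0 : ℝ),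
      (exp (-t) * (bernoulliRemainder 0 t + 1 / 2) -
        exp (-((n + 1 : ℕ) * t)) * (bernoulliRemainder 0 t - 1 / 2)) * laplaceWeight t) atTop
      (nhds (∫ t in Set.Ioi (0 : ℝ),
        (exp (-t) * (bernoulliRemainder 0 t + 1 / 2)) * laplaceWeight t)) := by
    refine tendsto_integral_of_dominated_convergence
      (fun t => 2 * ‖exp (-t) * laplaceWeight t‖) (fun n => ?_)
      (integrableOn_exp_neg_mul_laplaceWeight.norm.const_mul 2) (fun n => ?_) ?_
    · have := measurable_laplaceWeight
      have := measurable_bernoulliRemainder 0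
      exact Measurable.aestronglyMeasurable (by fun_prop)
    · filter_upwards [ae_restrict_mem measurableSet_Ioi] with t ht
      have ht : 0 < t := ht
      obtain ⟨h1, h2⟩ := bernoulliRemainder_zero_mem_Icc ht
      rw [norm_mul, norm_mul, ← mul_assoc]
      gcongr
      have h3 : exp (-((n + 1 : ℕ) * t)) ≤ exp (-t) := by
        rw [exp_le_exp]
        push_cast
        nlinarith [mul_nonneg (Nat.cast_nonneg (α := ℝ) n) ht.le]
      have h4 := exp_pos (-((n + 1 : ℕ) * t))
      rw [norm_of_nonneg (exp_pos (-t)).le, norm_eq_abs, abs_le]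
      constructor <;> nlinarith [exp_pos (-t)]
    · filter_upwards [ae_restrict_mem measurableSet_Ioi] with t ht
      have ht : 0 < t := ht
      have h : Tendsto (fun n : ℕ => exp (-((n + 1 : ℕ) * t))) atTop (nhds 0) :=
        tendsto_exp_neg_atTop_nhds_zero.comp
          (((tendsto_natCast_atTop_atTop (R := ℝ)).comp (tendsto_add_atTop_nat 1)).atTop_mul_const
            ht)
      simpa using ((h.mul_const (bernoulliRemainder 0 t - 1 / 2)).const_sub
        (exp (-t) * (bernoulliRemainder 0 t + 1 / 2))).mul_const (laplaceWeight t)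
  have h := tendsto_nhds_unique (hγ.comp (tendsto_add_atTop_nat 1))
    (hlim.congr fun n => (sum_log_sq_div_sub_eq_integral (by omega)).symm)
  have h1 := integrableOn_exp_neg_mul_laplaceWeight
  have h2 := integral_add (integrableOn_mul_bernoulliRemainder_zero h1) (h1.const_mul (1 / 2))
  rw [integral_const_mul, integral_exp_neg_mul_laplaceWeight, mul_zero, add_zero] at h2
  rw [h, ← h2]
  congr 1
  ext t
  ring

/-- The error made by truncating the series for the second Stieltjes constant after `N` terms. -/
noncomputable def stieltjesTwoRemainder (N : ℕ) : ℝ :=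
  ∫ t in Set.Ioi (0 : ℝ), exp (-t) * laplaceWeight t * bernoulliRemainder N t

lemma integrableOn_exp_neg_mul_laplaceWeight_mul_bernoulliRemainder (N : ℕ) :
    IntegrableOn (fun t => exp (-t) * laplaceWeight t * bernoulliRemainder N t) (Set.Ioi 0) := by
  induction N with
  | zero => exact integrableOn_mul_bernoulliRemainder_zero integrableOn_exp_neg_mul_laplaceWeight
  | succ N ih =>
    refine IntegrableOn.congr_fun (ih.sub
      ((integrableOn_exp_neg_mul_pow_mul_laplaceWeight (2 * N + 1)).const_mul
        (((bernoulli (2 * (N + 1)) : ℚ) : ℝ) / (2 * (N + 1)).factorial)))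
      (fun t _ => ?_) measurableSet_Ioi
    simp only [Pi.sub_apply]
    rw [bernoulliRemainder_succ]
    ring

lemma stieltjesTwoRemainder_succ (N : ℕ) :
    stieltjesTwoRemainder N = ((bernoulli (2 * N + 2) : ℚ) : ℝ) *
      ((H (2 * N + 1)) ^ 2 - Hgen (2 * N + 1) 2) / (2 * N + 2) + stieltjesTwoRemainder (N + 1) := by
  have h := integral_sub (integrableOn_exp_neg_mul_laplaceWeight_mul_bernoulliRemainder N)
    ((integrableOn_exp_neg_mul_pow_mul_laplaceWeight (2 * N + 1)).const_mul
        (((bernoulli (2 * (N + 1)) : ℚ) : ℝ) / (2 * (N + 1)).factorial))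
  rw [integral_const_mul, integral_exp_neg_mul_pow_mul_laplaceWeight] at h
  have h2 : stieltjesTwoRemainder (N + 1) = ∫ t in Set.Ioi (0 : ℝ),
      (exp (-t) * laplaceWeight t * bernoulliRemainder N t -
        ((bernoulli (2 * (N + 1)) : ℚ) : ℝ) / (2 * (N + 1)).factorial *
        (exp (-t) * t ^ (2 * N + 1) * laplaceWeight t)) := by
    rw [stieltjesTwoRemainder]
    congr 1
    ext t
    rw [bernoulliRemainder_succ]
    ring
  rw [h2, h, stieltjesTwoRemainder, show 2 * (N + 1) = 2 * N + 1 + 1 by ring,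
    Nat.factorial_succ (2 * N + 1)]
  push_cast
  have : ((2 * N + 1).factorial : ℝ) ≠ 0 := by positivity
  field_simp
  ring

lemma stieltjes_two_eq_sum_add_remainder {γ₂ : ℝ}
    (hγ : Tendsto (fun n : ℕ =>
        (∑ k ∈ Finset.range n, (Real.log (k + 1)) ^ 2 / (k + 1)) - (Real.log n) ^ 3 / 3)
      atTop (nhds γ₂)) (N : ℕ) :
    γ₂ = (1 / 2) * (∑ k ∈ Finset.Icc 1 N, ((bernoulli (2 * k) : ℚ) : ℝ) *
      ((H (2 * k - 1)) ^ 2 - Hgen (2 * k - 1) 2) / k) + stieltjesTwoRemainder N := by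
  induction N with
  | zero => simpa [stieltjesTwoRemainder] using stieltjes_two_eq_integral hγ
  | succ N ih =>
    rw [Finset.sum_Icc_succ_top (by omega), show 2 * (N + 1) - 1 = 2 * N + 1 by omega,
      show 2 * (N + 1) = 2 * N + 2 by ring]
    rw [stieltjesTwoRemainder_succ] at ih
    rw [ih]
    push_cast
    field_simp
    ring

lemma setIntegral_Ioi_pos_of_nonneg {f : ℝ → ℝ} (hf : IntegrableOn f (Set.Ioi 0))
    (h0 : ∀ t, 0 < t → 0 ≤ f t) {c : ℝ} (hc : 0 ≤ c) (hpos : ∀ t, c < t → 0 < f t) :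
    0 < ∫ t in Set.Ioi (0 : ℝ), f t := by
  rw [setIntegral_pos_iff_support_of_nonneg_ae _ hf]
  · refine lt_of_lt_of_le ?_ (measure_mono (s := Set.Ioi c) fun t ht =>
      ⟨(hpos t ht).ne', hc.trans_lt ht⟩)
    simp
  · filter_upwards [ae_restrict_mem measurableSet_Ioi] with t ht using h0 t ht

lemma sq_gammaLogMoment_one_lt : gammaLogMoment 0 1 ^ 2 < gammaLogMoment 0 2 := by
  set g := gammaLogMoment 0 1 with hg
  have hq : ∀ t, log t ^ 2 + -2 * g * log t + g ^ 2 = (log t - g) ^ 2 := fun t => by ring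
  have h := setIntegral_Ioi_pos_of_nonneg
    (integrableOn_exp_neg_mul_pow_mul_log_quadratic 0 (-2 * g) (g ^ 2))
    (fun t _ => by rw [hq]; positivity) (c := exp g) (exp_pos g).le fun t ht => by
      have : 0 < log t - g := sub_pos.2 ((lt_log_iff_exp_lt ((exp_pos g).trans ht)).2 ht)
      rw [hq]
      positivity
  rw [integral_exp_neg_mul_pow_mul_log_quadratic, gammaLogMoment_zero, ← hg] at h
  simp only [Nat.factorial_zero, Nat.cast_one] at h
  linarith

/-- `laplaceWeight` is negative between two points of the positive half-line, and positive elsewhere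
on it. -/
lemma exists_laplaceWeight_sign :
    ∃ u v : ℝ, 0 < u ∧ u < v ∧ laplaceWeight u = 0 ∧ laplaceWeight v = 0 ∧
      ∀ t, 0 < t → t ≠ u → t ≠ v → 0 < (t - u) * (t - v) * laplaceWeight t := by
  set g := gammaLogMoment 0 1 with hg
  have hσ : 0 < gammaLogMoment 0 2 - g ^ 2 := sub_pos.2 sq_gammaLogMoment_one_lt
  set s := √(gammaLogMoment 0 2 - g ^ 2) with hs
  have hs0 : 0 < s := Real.sqrt_pos.2 hσ
  have hs2 : s ^ 2 = gammaLogMoment 0 2 - g ^ 2 := Real.sq_sqrt hσ.le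
  have hq : ∀ t, laplaceWeight t = (log t - (g - s)) * (log t - (g + s)) := fun t => by
    rw [laplaceWeight, ← hg]
    linear_combination hs2
  have hsign : ∀ t a, 0 < t → t ≠ exp a → 0 < (t - exp a) * (log t - a) := fun t a ht hne => by
    rcases lt_or_gt_of_ne hne with h | h
    · exact mul_pos_of_neg_of_neg (sub_neg.2 h) (sub_neg.2 ((log_lt_iff_lt_exp ht).2 h))
    · exact mul_pos (sub_pos.2 h) (sub_pos.2 ((lt_log_iff_exp_lt ht).2 h))
  refine ⟨exp (g - s), exp (g + s), exp_pos _, exp_lt_exp.2 (by linarith), by simp [hq],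
    by simp [hq], fun t ht h1 h2 => ?_⟩
  rw [hq]
  have := mul_pos (hsign t _ ht h1) (hsign t _ ht h2)
  linarith

lemma neg_one_pow_mul_stieltjesTwoRemainder_pos {N : ℕ} (hN : 2 ≤ N) :
    0 < (-1) ^ N * stieltjesTwoRemainder N := by
  obtain ⟨u, v, hu, huv, hqu, hqv, hq⟩ := exists_laplaceWeight_sign
  obtain ⟨a, b, hab⟩ := (strictConvexOn_bernoulliRemainder hN).exists_secant hu huv
  have hi := (integrableOn_exp_neg_mul_laplaceWeight_mul_bernoulliRemainder N).const_mul
    ((-1 : ℝ) ^ N)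
  have h0 := integrableOn_exp_neg_mul_laplaceWeight.const_mul a
  have h1 := (integrableOn_exp_neg_mul_pow_mul_laplaceWeight 1).const_mul b
  have h01 : IntegrableOn (fun t => a * (exp (-t) * laplaceWeight t) +
      b * (exp (-t) * t ^ 1 * laplaceWeight t)) (Set.Ioi 0) := h0.add h1
  have heq : (-1) ^ N * stieltjesTwoRemainder N = ∫ t in Set.Ioi (0 : ℝ),
      ((-1) ^ N * (exp (-t) * laplaceWeight t * bernoulliRemainder N t) -
        (a * (exp (-t) * laplaceWeight t) + b * (exp (-t) * t ^ 1 * laplaceWeight t))) := by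
    rw [integral_sub hi h01, integral_add h0 h1, integral_const_mul, integral_const_mul,
      integral_const_mul, integral_exp_neg_mul_laplaceWeight,
      integral_exp_neg_mul_pow_mul_laplaceWeight, stieltjesTwoRemainder]
    simp [H, Hgen]
  have hpos : ∀ t, 0 < t → t ≠ u → t ≠ v →
      0 < (-1) ^ N * (exp (-t) * laplaceWeight t * bernoulliRemainder N t) -
        (a * (exp (-t) * laplaceWeight t) + b * (exp (-t) * t ^ 1 * laplaceWeight t)) := by
    intro t ht htu htv
    have h3 := mul_pos (hq t ht htu htv) (hab t ht htu htv)
    have h5 : 0 < laplaceWeight t * ((-1) ^ N * bernoulliRemainder N t - (a + b * t)) := by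
      refine pos_of_mul_pos_right (a := ((t - u) * (t - v)) ^ 2) ?_ (sq_nonneg _)
      linarith
    have h6 := mul_pos (exp_pos (-t)) h5
    linarith
  rw [heq]
  refine setIntegral_Ioi_pos_of_nonneg (hi.sub h01) (fun t ht => ?_) (hu.trans huv).le
    fun t ht => hpos t ((hu.trans huv).trans ht) (huv.trans ht).ne' (ne_of_gt ht)
  by_cases htu : t = u
  · rw [htu, hqu]
    simp
  by_cases htv : t = v
  · rw [htv, hqv]
    simp
  exact (hpos t ht htu htv).le

lemma stieltjesTwoRemainder_two_lt : stieltjesTwoRemainder 2 < 1 / 60 := by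
  have h3 := neg_one_pow_mul_stieltjesTwoRemainder_pos (N := 3) (by norm_num)
  have h := stieltjesTwoRemainder_succ 2
  have hb5 : bernoulli' 5 = 0 := bernoulli'_eq_zero_of_odd (by decide) (by norm_num)
  have hb : bernoulli 6 = 1 / 42 := by
    rw [bernoulli_eq_bernoulli'_of_ne_one (by norm_num), bernoulli'_def]
    norm_num [Finset.sum_range_succ, hb5, Nat.choose]
  norm_num [hb, H, Hgen, Finset.sum_range_succ] at h h3
  linarith

/-- Semi-convergent series with rational terms for the second Stieltjes constant
`γ₂ = lim (Σ_{k=1}^n ln² k / k − ln³ n / 3)`: for every `N ≥ 1` there is `θ ∈ (0,1)` with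
`γ₂ = (1/2) Σ_{k=1}^N B_{2k}(H_{2k−1}² − H_{2k−1}^{(2)})/k
 + θ B_{2N+2}(H_{2N+1}² − H_{2N+1}^{(2)})/(2N+2)`. -/
theorem second_stieltjes_enveloping_series (N : ℕ) (hN : 1 ≤ N) (γ₂ : ℝ)
    (hγ : Tendsto (fun n : ℕ =>
        (∑ k ∈ Finset.range n, (Real.log (k + 1)) ^ 2 / (k + 1)) - (Real.log n) ^ 3 / 3)
      atTop (nhds γ₂)) :
    ∃ θ : ℝ, θ ∈ Set.Ioo (0 : ℝ) 1 ∧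
      γ₂ = (1 / 2) * (∑ k ∈ Finset.Icc 1 N,
              ((bernoulli (2 * k) : ℚ) : ℝ) *
                ((H (2 * k - 1)) ^ 2 - Hgen (2 * k - 1) 2) / k) +
            θ * ((bernoulli (2 * N + 2) : ℚ) : ℝ) *
              ((H (2 * N + 1)) ^ 2 - Hgen (2 * N + 1) 2) / (2 * N + 2) := by
  have hγ' := stieltjes_two_eq_sum_add_remainder hγ N
  have hsucc := stieltjesTwoRemainder_succ N
  set T := ((bernoulli (2 * N + 2) : ℚ) : ℝ) *
    ((H (2 * N + 1)) ^ 2 - Hgen (2 * N + 1) 2) / (2 * N + 2) with hT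
  suffices h : ∃ θ ∈ Set.Ioo (0 : ℝ) 1, stieltjesTwoRemainder N = θ * T by
    obtain ⟨θ, hθ, h⟩ := h
    refine ⟨θ, hθ, ?_⟩
    rw [hγ', h, hT]
    ring
  rcases hN.eq_or_lt with rfl | hN2
  · have hpos := neg_one_pow_mul_stieltjesTwoRemainder_pos (le_refl 2)
    have hlt := stieltjesTwoRemainder_two_lt
    have hb : bernoulli 4 = -1 / 30 := by
      rw [bernoulli_eq_bernoulli'_of_ne_one (by norm_num), bernoulli'_four]
    have hTval : T = -1 / 60 := by
      rw [hT]
      norm_num [hb, H, Hgen, Finset.sum_range_succ]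
    norm_num at hpos hsucc
    refine ⟨1 - 60 * stieltjesTwoRemainder 2, ⟨by linarith, by linarith⟩, ?_⟩
    rw [hsucc, hTval]
    ring_nf
  · have h1 := neg_one_pow_mul_stieltjesTwoRemainder_pos hN2
    have h2 := neg_one_pow_mul_stieltjesTwoRemainder_pos (N := N + 1) (by omega)
    have hs : (-1 : ℝ) ^ N * T = (-1) ^ N * stieltjesTwoRemainder N +
        (-1) ^ (N + 1) * stieltjesTwoRemainder (N + 1) := by
      rw [hsucc]
      ring
    have hT0 : 0 < (-1 : ℝ) ^ N * T := by linarith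
    refine ⟨(-1) ^ N * stieltjesTwoRemainder N / ((-1) ^ N * T),
      ⟨div_pos h1 hT0, (div_lt_one hT0).2 (by linarith)⟩, ?_⟩
    have hT1 : T ≠ 0 := right_ne_zero_of_mul hT0.ne'
    field_simp
end
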